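/- arXiv:2403.09031 — 2 statements merged into one kernel-verified Lean document; each statement's English description precedes it below -/
import Mathlib

section
/- Lemma 5. Let U, U⋆ ∈ ℂ^{n_s×r} have orthonormal columns (UᴴU = I = U⋆ᴴU⋆), let Σ, Σ⋆ ∈ ℝ^{r×r} be diagonal with nonnegative entries, and suppose every diagonal entry of Σ⋆ is at least s for some s > 0. Set M = UΣUᵀ, M⋆ = U⋆Σ⋆U⋆ᵀ, Z = UΣ^{1/2}, Z⋆ = U⋆Σ⋆^{1/2}. Then dist_P(Z, Z⋆)² ≤ 2·inf{ ‖Z − Z⋆Q‖_F² : Q ∈ ℝ^{r×r} real orthogonal } ≤ ((√2 + 1)/s)·‖M − M⋆‖_F². -/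
open Matrix
open scoped BigOperators

noncomputable section

/-- Frobenius norm of a complex matrix. -/
def frobNorm {m n : ℕ} (A : Matrix (Fin m) (Fin n) ℂ) : ℝ :=
  Real.sqrt (∑ i, ∑ j, ‖A i j‖ ^ 2)

/-- Distance via alignment over invertible matrices. -/
def distP {ns r : ℕ} (Z Zs : Matrix (Fin ns) (Fin r) ℂ) : ℝ :=
  sInf {t : ℝ | ∃ P : Matrix (Fin r) (Fin r) ℂ, IsUnit P ∧
    t = Real.sqrt (frobNorm (Z - Zs * P) ^ 2 + frobNorm (Z - Zs * (P⁻¹)ᵀ) ^ 2)}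

section Procrustes

variable {m n : Type*} [Fintype m] [Fintype n]

lemma trace_transpose_mul_self_nonneg (A : Matrix m n ℝ) : 0 ≤ trace (Aᵀ * A) := by
  have := (posSemidef_conjTranspose_mul_self A).trace_nonneg
  rwa [conjTranspose_eq_transpose_of_trivial] at this

lemma trace_transpose_mul_self_mul_nonneg (H : Matrix m n ℝ) {S : Matrix n n ℝ}
    (hS : S.PosSemidef) : 0 ≤ trace (Hᵀ * H * S) := by
  have := (hS.mul_mul_conjTranspose_same H).trace_nonneg
  rwa [conjTranspose_eq_transpose_of_trivial, trace_mul_cycle] at this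

lemma trace_gram_sub_gram (X Y : Matrix m n ℝ) :
    trace ((X * Xᵀ - Y * Yᵀ)ᵀ * (X * Xᵀ - Y * Yᵀ)) =
      trace ((Xᵀ * X) * (Xᵀ * X)) - 2 * trace ((Xᵀ * Y)ᵀ * (Xᵀ * Y))
        + trace ((Yᵀ * Y) * (Yᵀ * Y)) := by
  have h : ∀ V W : Matrix m n ℝ, trace (V * Vᵀ * (W * Wᵀ)) = trace ((Vᵀ * W)ᵀ * (Vᵀ * W)) := by
    intro V W
    rw [← Matrix.mul_assoc, trace_mul_comm]
    simp only [transpose_mul, transpose_transpose, Matrix.mul_assoc]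
  have hc : trace (Y * Yᵀ * (X * Xᵀ)) = trace (X * Xᵀ * (Y * Yᵀ)) := trace_mul_comm _ _
  have hX := h X X
  have hY := h Y Y
  have hXY := h X Y
  simp only [transpose_sub, transpose_mul, transpose_transpose, sub_mul, mul_sub, trace_sub]
    at hX hY hXY hc ⊢
  linarith

variable [DecidableEq n]

/-- The Householder reflection in the hyperplane orthogonal to `v`. -/
def householder (v : n → ℝ) : Matrix n n ℝ :=
  1 - (2 / (v ⬝ᵥ v)) • vecMulVec v v

lemma householder_mul (v : n → ℝ) (B : Matrix n n ℝ) :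
    householder v * B = B - (2 / (v ⬝ᵥ v)) • vecMulVec v (v ᵥ* B) := by
  simp [householder, sub_mul, vecMulVec_mul]

lemma householder_mem_orthogonalGroup {v : n → ℝ} (hv : v ⬝ᵥ v ≠ 0) :
    householder v ∈ orthogonalGroup n ℝ := by
  rw [mem_orthogonalGroup_iff']
  have ht : (householder v)ᵀ = householder v := by
    simp [householder, transpose_vecMulVec]
  rw [ht, householder_mul]
  ext i j
  simp [householder, vecMul_sub, vecMul_smul, vecMul_vecMulVec, vecMulVec_apply]
  field_simp
  ring

lemma trace_householder_mul (v : n → ℝ) (B : Matrix n n ℝ) :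
    trace (householder v * B) = trace B - 2 / (v ⬝ᵥ v) * (v ⬝ᵥ B *ᵥ v) := by
  rw [householder_mul, trace_sub, trace_smul, trace_vecMulVec, smul_eq_mul, dotProduct_mulVec,
    dotProduct_comm v (v ᵥ* B)]

lemma isCompact_orthogonalGroup : IsCompact (orthogonalGroup n ℝ : Set (Matrix n n ℝ)) := by
  have hc : IsCompact (Set.univ.pi fun _ : n => Set.univ.pi fun _ : n => Set.Icc (-1 : ℝ) 1) :=
    isCompact_univ_pi fun _ => isCompact_univ_pi fun _ => isCompact_Icc
  refine hc.of_isClosed_subset ?_ ?_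
  · have : (orthogonalGroup n ℝ : Set (Matrix n n ℝ)) = {A | A * Aᵀ = 1} := by
      ext A
      exact mem_orthogonalGroup_iff n ℝ
    rw [this]
    exact isClosed_eq (by fun_prop) continuous_const
  · intro A hA i _ j _
    have := entry_norm_bound_of_unitary hA i j
    rwa [Real.norm_eq_abs, abs_le] at this

/-- If the trace of `B` cannot be increased by a rotation, then `B` is positive semidefinite. -/
lemma posSemidef_of_trace_mul_le {B : Matrix n n ℝ}
    (hB : ∀ R ∈ orthogonalGroup n ℝ, trace (R * B) ≤ trace B) : B.PosSemidef := by
  have hnonneg : ∀ v : n → ℝ, 0 ≤ v ⬝ᵥ B *ᵥ v := by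
    intro v
    by_cases hv : v = 0
    · simp [hv]
    have hpos : 0 < v ⬝ᵥ v :=
      lt_of_le_of_ne (Finset.sum_nonneg fun i _ => mul_self_nonneg (v i))
        fun h => hv (dotProduct_self_eq_zero.1 h.symm)
    have h := hB _ (householder_mem_orthogonalGroup hpos.ne')
    rw [trace_householder_mul] at h
    exact nonneg_of_mul_nonneg_right (by linarith : 0 ≤ 2 / (v ⬝ᵥ v) * _) (by positivity)
  have hsymm : ∀ i j, B j i = B i j := by
    intro i j
    by_cases hij : i = j
    · rw [hij]
    have hquad : ∀ t : ℝ, t * (B j i - B i j) ≤ t ^ 2 * (B i i + B j j) := by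
      intro t
      set e : n → ℝ := Pi.single i 1 with he
      set w : n → ℝ := Pi.single i 1 + Pi.single j t with hw
      have hww : w ⬝ᵥ w = 1 + t ^ 2 := by
        simp [hw, hij, Ne.symm hij, sq]
      have hee : e ⬝ᵥ e = 1 := by simp [he]
      have hwe : e ⬝ᵥ w = 1 := by simp [he, hw, hij]
      have hpos : 0 < 1 + t ^ 2 := by positivity
      have h := hB _ (mul_mem (householder_mem_orthogonalGroup (by rw [hee]; norm_num : e ⬝ᵥ e ≠ 0))
        (householder_mem_orthogonalGroup (by rw [hww]; exact hpos.ne' : w ⬝ᵥ w ≠ 0)))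
      rw [Matrix.mul_assoc, trace_householder_mul, trace_householder_mul, householder_mul,
        sub_mulVec, smul_mulVec, vecMulVec_mulVec, dotProduct_sub, dotProduct_smul,
        hee, hww, dotProduct_smul, hwe, ← dotProduct_mulVec] at h
      have h1 : w ⬝ᵥ B *ᵥ w = B i i + t * (B i j + B j i) + t ^ 2 * B j j := by
        simp [hw, mulVec_add, add_dotProduct]
        ring
      have h2 : w ⬝ᵥ B *ᵥ e = B i i + t * B j i := by
        simp [hw, he, add_dotProduct]
      have h3 : e ⬝ᵥ B *ᵥ e = B i i := by simp [he]
      rw [h1, h2, h3] at h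
      simp only [MulOpposite.smul_eq_mul_unop, MulOpposite.unop_op, smul_eq_mul] at h
      field_simp at h
      nlinarith [h]
    have hc : 0 ≤ B i i + B j j := by
      have h1 := hnonneg (Pi.single i 1)
      have h2 := hnonneg (Pi.single j 1)
      simp at h1 h2
      linarith
    set c := B i i + B j j
    set d := B j i - B i j with hd
    have h := hquad (d / (c + 1))
    have hc1 : 0 < c + 1 := by linarith
    rw [div_pow, div_mul_eq_mul_div, div_mul_eq_mul_div, div_le_div_iff₀ hc1 (by positivity)] at h
    have hd0 : d * d ≤ 0 := by
      by_contra! hlt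
      nlinarith [mul_pos hlt hc1]
    have : d = 0 := mul_self_eq_zero.1 (le_antisymm hd0 (mul_self_nonneg d))
    linarith
  refine PosSemidef.of_dotProduct_mulVec_nonneg ?_ fun v => by simpa using hnonneg v
  ext i j
  simpa using hsymm i j

/-- Polar decomposition of a real square matrix. -/
lemma exists_orthogonal_mul_posSemidef (B : Matrix n n ℝ) :
    ∃ Q : Matrix n n ℝ, Q * Qᵀ = 1 ∧ Qᵀ * Q = 1 ∧ (B * Q).PosSemidef := by
  obtain ⟨Q, hQ, hmax⟩ := isCompact_orthogonalGroup.exists_isMaxOn ⟨1, one_mem _⟩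
    (f := fun Q : Matrix n n ℝ => trace (B * Q)) (by fun_prop)
  refine ⟨Q, (mem_orthogonalGroup_iff n ℝ).1 hQ, (mem_orthogonalGroup_iff' n ℝ).1 hQ,
    posSemidef_of_trace_mul_le fun R hR => ?_⟩
  have := hmax (mul_mem hQ hR)
  rw [trace_mul_comm, Matrix.mul_assoc]
  exact this

lemma trace_sub_gram_le {X Y : Matrix m n ℝ} {s : ℝ} (hW : (Xᵀ * Y).PosSemidef)
    (hY : (Yᵀ * Y - s • (1 : Matrix n n ℝ)).PosSemidef) :
    2 * (Real.sqrt 2 - 1) * s * trace ((X - Y)ᵀ * (X - Y)) ≤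
      trace ((X * Xᵀ - Y * Yᵀ)ᵀ * (X * Xᵀ - Y * Yᵀ)) := by
  have hWt : (Xᵀ * Y)ᵀ = Xᵀ * Y := by
    rw [← conjTranspose_eq_transpose_of_trivial]
    exact hW.isHermitian
  have hYX : Yᵀ * X = Xᵀ * Y := by
    rw [← hWt, transpose_mul, transpose_transpose]
  have hAt : (Xᵀ * X)ᵀ = Xᵀ * X := by simp
  have hLt : (Yᵀ * Y)ᵀ = Yᵀ * Y := by simp
  have hG : (X - Y)ᵀ * (X - Y) = Xᵀ * X - Xᵀ * Y - Xᵀ * Y + Yᵀ * Y := by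
    rw [transpose_sub, Matrix.sub_mul, Matrix.mul_sub, Matrix.mul_sub, hYX]
    abel
  have h1 := trace_transpose_mul_self_mul_nonneg (X - Y) hW
  have h2 := trace_transpose_mul_self_mul_nonneg (X - Y) hY
  have h3 := trace_transpose_mul_self_nonneg
    ((X - Y)ᵀ * (X - Y) + Real.sqrt 2 • (Xᵀ * Y - Yᵀ * Y))
  rw [trace_gram_sub_gram, hWt]
  rw [hG] at h1 h2 h3 ⊢
  generalize Xᵀ * X = A at *
  generalize Xᵀ * Y = W at *
  generalize Yᵀ * Y = L at *
  have hr : Real.sqrt 2 ^ 2 = 2 := Real.sq_sqrt (by norm_num)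
  have hr1 : 1 ≤ Real.sqrt 2 := Real.one_le_sqrt.2 (by norm_num)
  have hr2 : Real.sqrt 2 ≤ 2 := by nlinarith
  have cWA : trace (W * A) = trace (A * W) := trace_mul_comm _ _
  have cLA : trace (L * A) = trace (A * L) := trace_mul_comm _ _
  have cLW : trace (L * W) = trace (W * L) := trace_mul_comm _ _
  simp only [transpose_sub, transpose_add, transpose_smul, hWt, hAt, hLt, sub_mul, mul_sub,
    add_mul, mul_add, Matrix.smul_mul, Matrix.mul_smul, mul_one, trace_sub, trace_add, trace_smul,
    smul_eq_mul, cWA, cLA, cLW] at h1 h2 h3 ⊢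
  have h1' := mul_nonneg (by linarith : 0 ≤ 4 - 2 * Real.sqrt 2) h1
  have h2' := mul_nonneg (by linarith : 0 ≤ 2 * Real.sqrt 2 - 2) h2
  linear_combination h1' + h2' + h3 + (trace (W * W) - 2 * trace (W * L) + trace (L * L)) * hr

/-- Procrustes alignment is controlled by the distance between Gram matrices. -/
lemma exists_orthogonal_alignment (X Y : Matrix m n ℝ) (s : ℝ)
    (hY : (Yᵀ * Y - s • (1 : Matrix n n ℝ)).PosSemidef) :
    ∃ Q : Matrix n n ℝ, Q * Qᵀ = 1 ∧ Qᵀ * Q = 1 ∧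
      2 * (Real.sqrt 2 - 1) * s * trace ((X - Y * Q)ᵀ * (X - Y * Q)) ≤
        trace ((X * Xᵀ - Y * Yᵀ)ᵀ * (X * Xᵀ - Y * Yᵀ)) := by
  obtain ⟨Q, hQ, hQ', hpos⟩ := exists_orthogonal_mul_posSemidef (Xᵀ * Y)
  refine ⟨Q, hQ, hQ', ?_⟩
  have hYQ : (Y * Q) * (Y * Q)ᵀ = Y * Yᵀ := by
    rw [transpose_mul, Matrix.mul_assoc, ← Matrix.mul_assoc Q, hQ, Matrix.one_mul]
  have hgram : (Y * Q)ᵀ * (Y * Q) - s • (1 : Matrix n n ℝ)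
      = Qᵀ * (Yᵀ * Y - s • (1 : Matrix n n ℝ)) * Q := by
    simp [transpose_mul, mul_sub, sub_mul, Matrix.mul_assoc, hQ']
  have hYQs : ((Y * Q)ᵀ * (Y * Q) - s • (1 : Matrix n n ℝ)).PosSemidef := by
    rw [hgram, ← conjTranspose_eq_transpose_of_trivial]
    exact hY.conjTranspose_mul_mul_same Q
  have h := trace_sub_gram_le (X := X) (Y := Y * Q) (by rwa [← Matrix.mul_assoc]) hYQs
  rwa [hYQ] at h

end Procrustes

section Realification

variable {m n : ℕ}

/-- The real matrix obtained by stacking the real part of `Z` on its imaginary part. -/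
def realStack (Z : Matrix (Fin m) (Fin n) ℂ) : Matrix (Fin m ⊕ Fin m) (Fin n) ℝ :=
  fromRows (Z.map Complex.re) (Z.map Complex.im)

lemma realStack_sub (Z W : Matrix (Fin m) (Fin n) ℂ) :
    realStack (Z - W) = realStack Z - realStack W := by
  ext (i | i) j <;> simp [realStack]

lemma realStack_mul_map_ofReal (Z : Matrix (Fin m) (Fin n) ℂ) (Q : Matrix (Fin n) (Fin n) ℝ) :
    realStack (Z * Q.map (fun x => (x : ℂ))) = realStack Z * Q := by
  ext (i | i) j <;> simp [realStack, mul_apply]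

lemma realStack_transpose_mul (Z W : Matrix (Fin m) (Fin n) ℂ) :
    (realStack Z)ᵀ * realStack W = (Zᴴ * W).map Complex.re := by
  ext i j
  simp [realStack, mul_apply, Finset.sum_add_distrib]

lemma frobNorm_sq (A : Matrix (Fin m) (Fin n) ℂ) : frobNorm A ^ 2 = ∑ i, ∑ j, ‖A i j‖ ^ 2 :=
  Real.sq_sqrt (by positivity)

lemma frobNorm_sq_eq_re_trace (A : Matrix (Fin m) (Fin n) ℂ) :
    frobNorm A ^ 2 = (trace (Aᴴ * A)).re := by
  rw [frobNorm_sq, Finset.sum_comm]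
  simp [trace, mul_apply, ← Complex.normSq_eq_norm_sq, Complex.normSq_apply]

lemma frobNorm_sq_eq_trace_realStack (A : Matrix (Fin m) (Fin n) ℂ) :
    frobNorm A ^ 2 = trace ((realStack A)ᵀ * realStack A) := by
  rw [frobNorm_sq_eq_re_trace, realStack_transpose_mul]
  simp [trace]

lemma trace_conjTranspose_symm_mul_symm (Z W : Matrix (Fin m) (Fin n) ℂ) :
    trace ((Z * Zᵀ)ᴴ * (W * Wᵀ)) = trace ((Zᴴ * W)ᵀ * (Zᴴ * W)) := by
  rw [conjTranspose_mul, ← Matrix.mul_assoc, trace_mul_comm, transpose_mul]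
  simp only [Matrix.mul_assoc]
  rfl

lemma re_trace_transpose_mul_self_le (W : Matrix (Fin m) (Fin n) ℂ) :
    (trace (Wᵀ * W)).re ≤ trace ((W.map Complex.re)ᵀ * W.map Complex.re) := by
  simp only [trace, diag_apply, mul_apply, transpose_apply, map_apply, Complex.re_sum,
    Complex.mul_re]
  exact Finset.sum_le_sum fun i _ => Finset.sum_le_sum fun j _ =>
    sub_le_self _ (mul_self_nonneg _)

/-- When the Gram matrices of `Z` and `W` are real diagonal, the realified Gram difference is
dominated by the difference of the complex symmetric products. -/
lemma trace_realStack_le_frobNorm_sq (Z W : Matrix (Fin m) (Fin n) ℂ) {d e : Fin n → ℝ}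
    (hZ : Zᴴ * Z = diagonal fun k => (d k : ℂ)) (hW : Wᴴ * W = diagonal fun k => (e k : ℂ)) :
    trace ((realStack Z * (realStack Z)ᵀ - realStack W * (realStack W)ᵀ)ᵀ *
        (realStack Z * (realStack Z)ᵀ - realStack W * (realStack W)ᵀ)) ≤
      frobNorm (Z * Zᵀ - W * Wᵀ) ^ 2 := by
  have hdiag : ∀ f : Fin n → ℝ, (trace ((diagonal fun k => (f k : ℂ))ᵀ *
      diagonal fun k => (f k : ℂ))).re = trace ((diagonal fun k => (f k : ℂ)).map Complex.re *
        (diagonal fun k => (f k : ℂ)).map Complex.re) := by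
    intro f
    simp [diagonal_map]
  have hcross : (trace ((W * Wᵀ)ᴴ * (Z * Zᵀ))).re = (trace ((Z * Zᵀ)ᴴ * (W * Wᵀ))).re := by
    rw [← Complex.conj_re, ← Complex.star_def, ← trace_conjTranspose,
      conjTranspose_mul, conjTranspose_conjTranspose]
  rw [trace_gram_sub_gram, realStack_transpose_mul, realStack_transpose_mul,
    realStack_transpose_mul, frobNorm_sq_eq_re_trace, conjTranspose_sub, sub_mul, mul_sub, mul_sub,
    trace_sub, trace_sub, trace_sub, Complex.sub_re, Complex.sub_re, Complex.sub_re, hcross,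
    trace_conjTranspose_symm_mul_symm, trace_conjTranspose_symm_mul_symm,
    trace_conjTranspose_symm_mul_symm, hZ, hW, hdiag, hdiag]
  linarith [re_trace_transpose_mul_self_le (Zᴴ * W)]

end Realification

section Takagi

variable {m n : ℕ} {U Z : Matrix (Fin m) (Fin n) ℂ} {d : Fin n → ℝ}

lemma conjTranspose_mul_self_of_eq_mul_diagonal_sqrt (hU : Uᴴ * U = 1) (hd : ∀ k, 0 ≤ d k)
    (hZ : Z = U * diagonal (fun k => (Real.sqrt (d k) : ℂ))) :
    Zᴴ * Z = diagonal fun k => (d k : ℂ) := by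
  rw [hZ, conjTranspose_mul, Matrix.mul_assoc, ← Matrix.mul_assoc Uᴴ, hU, Matrix.one_mul,
    diagonal_conjTranspose, diagonal_mul_diagonal]
  congr 1
  ext k
  simp [← Complex.ofReal_mul, Real.mul_self_sqrt (hd k)]

lemma mul_transpose_of_eq_mul_diagonal_sqrt (hd : ∀ k, 0 ≤ d k)
    (hZ : Z = U * diagonal (fun k => (Real.sqrt (d k) : ℂ))) :
    Z * Zᵀ = U * diagonal (fun k => (d k : ℂ)) * Uᵀ := by
  rw [hZ, transpose_mul, diagonal_transpose, Matrix.mul_assoc, ← Matrix.mul_assoc (diagonal _),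
    diagonal_mul_diagonal, ← Matrix.mul_assoc]
  congr 3
  ext k
  simp [← Complex.ofReal_mul, Real.mul_self_sqrt (hd k)]

end Takagi

lemma distP_sq_le_of_orthogonal {m n : ℕ} (Z W : Matrix (Fin m) (Fin n) ℂ)
    {Q : Matrix (Fin n) (Fin n) ℝ} (hQ : Q * Qᵀ = 1) :
    distP Z W ^ 2 ≤ 2 * frobNorm (Z - W * Q.map (fun x => (x : ℂ))) ^ 2 := by
  set P : Matrix (Fin n) (Fin n) ℂ := Q.map (fun x => (x : ℂ))
  have hPP : P * Pᵀ = 1 := by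
    have h := congrArg (fun A : Matrix (Fin n) (Fin n) ℝ => A.map Complex.ofRealHom) hQ
    rw [Matrix.map_mul, Matrix.map_one _ (map_zero _) (map_one _)] at h
    exact h
  have hinv : (P⁻¹)ᵀ = P := by rw [inv_eq_right_inv hPP, transpose_transpose]
  have hle : distP Z W ≤ Real.sqrt (frobNorm (Z - W * P) ^ 2 + frobNorm (Z - W * (P⁻¹)ᵀ) ^ 2) :=
    csInf_le ⟨0, by rintro t ⟨P, _, rfl⟩; positivity⟩ ⟨P, IsUnit.of_mul_eq_one _ hPP, rfl⟩
  have h0 : 0 ≤ distP Z W := Real.sInf_nonneg (by rintro t ⟨P, _, rfl⟩; positivity)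
  rw [hinv] at hle
  calc distP Z W ^ 2 ≤ Real.sqrt (frobNorm (Z - W * P) ^ 2 + frobNorm (Z - W * P) ^ 2) ^ 2 := by
        gcongr
    _ = 2 * frobNorm (Z - W * P) ^ 2 := by
        rw [Real.sq_sqrt (by positivity)]
        ring

/-- Lemma 5: for Takagi factorizations `M = UΣUᵀ`, `M⋆ = U⋆Σ⋆U⋆ᵀ`, with
`Z = UΣ^{1/2}`, `Z⋆ = U⋆Σ⋆^{1/2}`,
`dist_P(Z,Z⋆)² ≤ 2·min_{Q real orthogonal} ‖Z − Z⋆Q‖_F² ≤ ((√2+1)/s)·‖M − M⋆‖_F²`. -/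
theorem takagi_distP_bound (ns r : ℕ)
    (U Us : Matrix (Fin ns) (Fin r) ℂ)
    (hU : Uᴴ * U = 1) (hUs : Usᴴ * Us = 1)
    (σ σs : Fin r → ℝ) (hσ : ∀ k, 0 ≤ σ k)
    (s : ℝ) (hs : 0 < s) (hσs : ∀ k, s ≤ σs k)
    (M Ms : Matrix (Fin ns) (Fin ns) ℂ)
    (hM : M = U * Matrix.diagonal (fun k => (σ k : ℂ)) * Uᵀ)
    (hMs : Ms = Us * Matrix.diagonal (fun k => (σs k : ℂ)) * Usᵀ)
    (Z Zs : Matrix (Fin ns) (Fin r) ℂ)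
    (hZ : Z = U * Matrix.diagonal (fun k => (Real.sqrt (σ k) : ℂ)))
    (hZs : Zs = Us * Matrix.diagonal (fun k => (Real.sqrt (σs k) : ℂ))) :
    distP Z Zs ^ 2
      ≤ 2 * sInf {t : ℝ | ∃ Q : Matrix (Fin r) (Fin r) ℝ,
          Q * Qᵀ = 1 ∧ Qᵀ * Q = 1 ∧
          t = frobNorm (Z - Zs * Q.map (fun x => (x : ℂ))) ^ 2}
    ∧ 2 * sInf {t : ℝ | ∃ Q : Matrix (Fin r) (Fin r) ℝ,
          Q * Qᵀ = 1 ∧ Qᵀ * Q = 1 ∧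
          t = frobNorm (Z - Zs * Q.map (fun x => (x : ℂ))) ^ 2}
      ≤ (Real.sqrt 2 + 1) / s * frobNorm (M - Ms) ^ 2 := by
  set S : Set ℝ := {t : ℝ | ∃ Q : Matrix (Fin r) (Fin r) ℝ,
    Q * Qᵀ = 1 ∧ Qᵀ * Q = 1 ∧ t = frobNorm (Z - Zs * Q.map (fun x => (x : ℂ))) ^ 2}
  refine ⟨?_, ?_⟩
  · suffices distP Z Zs ^ 2 / 2 ≤ sInf S by linarith
    refine le_csInf ⟨_, 1, by simp, by simp, rfl⟩ ?_
    rintro t ⟨Q, hQ, hQ', rfl⟩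
    linarith [distP_sq_le_of_orthogonal Z Zs hQ]
  · have hσs0 : ∀ k, 0 ≤ σs k := fun k => hs.le.trans (hσs k)
    have hG := conjTranspose_mul_self_of_eq_mul_diagonal_sqrt hU hσ hZ
    have hGs := conjTranspose_mul_self_of_eq_mul_diagonal_sqrt hUs hσs0 hZs
    have hMZ := mul_transpose_of_eq_mul_diagonal_sqrt hσ hZ
    have hMsZ := mul_transpose_of_eq_mul_diagonal_sqrt hσs0 hZs
    obtain ⟨Q, hQ, hQ', hle⟩ := exists_orthogonal_alignment (realStack Z) (realStack Zs) s (by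
      rw [realStack_transpose_mul, hGs]
      have : (diagonal fun k => (σs k : ℂ)).map Complex.re - s • (1 : Matrix (Fin r) (Fin r) ℝ)
          = diagonal fun k => σs k - s := by
        ext i j
        by_cases h : i = j <;> simp [one_apply, h]
      rw [this, posSemidef_diagonal_iff]
      exact fun k => sub_nonneg.2 (hσs k))
    have hcmp := trace_realStack_le_frobNorm_sq Z Zs hG hGs
    rw [hMZ, hMsZ, ← hM, ← hMs] at hcmp
    have hinf : sInf S ≤ frobNorm (Z - Zs * Q.map (fun x => (x : ℂ))) ^ 2 :=
      csInf_le ⟨0, by rintro t ⟨Q, _, _, rfl⟩; positivity⟩ ⟨Q, hQ, hQ', rfl⟩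
    rw [frobNorm_sq_eq_trace_realStack, realStack_sub, realStack_mul_map_ofReal] at hinf
    have h2 : Real.sqrt 2 ^ 2 = 2 := Real.sq_sqrt (by norm_num)
    have h1 : 0 < Real.sqrt 2 := by positivity
    rw [div_mul_eq_mul_div, le_div_iff₀ hs]
    have hkey := mul_le_mul_of_nonneg_left (hle.trans hcmp) (by positivity : 0 ≤ Real.sqrt 2 + 1)
    have hinf' := mul_le_mul_of_nonneg_left hinf hs.le
    linear_combination hkey + 2 * hinf' - (2 * s *
      trace ((realStack Z - realStack Zs * Q)ᵀ * (realStack Z - realStack Zs * Q))) * h2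
end
end

section
/- Lemma 2 (initialization conditions). There exist universal constants C, ε̄ > 0 such that for every ε₀ ∈ (0, ε̄] the following holds. Let n_s, r ≥ 1, n = 2n_s − 1, y ∈ ℂⁿ, and suppose M⋆ = 𝒢y = U⋆Σ⋆U⋆ᵀ, where U⋆ ∈ ℂ^{n_s×r} has orthonormal columns, Σ⋆ = diag(σ₁ ≥ … ≥ σ_r) with σ_r > 0, and ‖U⋆‖_{2,∞} ≤ √(2μ₀r/n) for some μ₀ > 0. Set Z⋆ = U⋆Σ⋆^{1/2}, κ = σ₁/σ_r, fix μ ≥ μ₀, and let m̂ ≥ C·ε₀⁻²·μ·κ⁴·r²·log n. Let a₁, …, a_{m̂} be i.i.d. uniform on {0,…,n−1}. Let M⁰ ∈ ℂ^{n_s×n_s} be any matrix of rank at most r minimizing ‖M⁰ − (n/m̂)·Σ_{j=1}^{m̂} y_{a_j}·𝒢(e_{a_j})‖ (spectral norm) over matrices of rank at most r, write M⁰ = U⁰Σ⁰(U⁰)ᵀ with U⁰ ∈ ℂ^{n_s×r} having orthonormal columns and Σ⁰ diagonal with nonnegative entries, set Z̃⁰ = U⁰(Σ⁰)^{1/2},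 σ = σ₁(M⁰)/(1 − ε₀), and Z⁰ = P_C(Z̃⁰) with row bound τ = 2√(μrσ/n). Then with probability at least 1 − n⁻² (over the random indices): (i) σ ≥ σ₁; (ii) dist_P(Z⁰, Z⋆) ≤ 1.6·κ⁻¹·ε₀·σ_r^{1/2}, and the infimum defining dist_P(Z⁰, Z⋆) is attained at some invertible P⁰ ∈ ℂ^{r×r}; (iii) setting Z⁰⋆₁ = Z⋆P⁰ and Z⁰⋆₂ = Z⋆(P⁰)^{−T}, for each i ∈ {1,2}: σ_min(Z⁰⋆ᵢ) ≥ (1 − 6.4·κ⁻¹·ε₀)·σ_r^{1/2} and ‖Z⁰⋆ᵢ‖ ≤ (1 + 6.4·κ⁻¹·ε₀)·σ₁^{1/2}. -/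
open Matrix
open scoped BigOperators Classical

noncomputable section

/-- Euclidean (ℓ₂) norm of a complex vector. -/
def vecNorm {n : ℕ} (v : Fin n → ℂ) : ℝ :=
  Real.sqrt (∑ i, ‖v i‖ ^ 2)

/-- Smallest singular value. -/
def sigmaMin {m n : ℕ} (A : Matrix (Fin m) (Fin n) ℂ) : ℝ :=
  sInf {t : ℝ | ∃ v : Fin n → ℂ, vecNorm v = 1 ∧ t = vecNorm (A.mulVec v)}

/-- Spectral norm (largest singular value). -/
def specNorm {m n : ℕ} (A : Matrix (Fin m) (Fin n) ℂ) : ℝ :=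
  sSup {t : ℝ | ∃ v : Fin n → ℂ, vecNorm v = 1 ∧ t = vecNorm (A.mulVec v)}

/-- `‖A‖_{2,∞}`: the largest ℓ₂ norm of the rows of `A`. -/
def norm2inf {m n : ℕ} (A : Matrix (Fin m) (Fin n) ℂ) : ℝ :=
  ⨆ i, vecNorm (A i)

/-- `w_a`: the length of the `a`-th skew diagonal of an `n_s × n_s` matrix. -/
def hw (ns : ℕ) (a : ℕ) : ℕ :=
  (Finset.univ.filter (fun p : Fin ns × Fin ns => (p.1 : ℕ) + (p.2 : ℕ) = a)).card

/-- The normalized Hankel lifting `𝒢`. -/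
def Gop (ns : ℕ) (z : Fin (2 * ns - 1) → ℂ) : Matrix (Fin ns) (Fin ns) ℂ :=
  fun i j => z ⟨(i : ℕ) + (j : ℕ), by have := i.isLt; have := j.isLt; omega⟩
    / ((Real.sqrt (hw ns ((i : ℕ) + (j : ℕ))) : ℝ) : ℂ)

/-- The row-wise clipping projection `P_C` with row bound `τ`. -/
def projC {ns r : ℕ} (τ : ℝ) (Z : Matrix (Fin ns) (Fin r) ℂ) :
    Matrix (Fin ns) (Fin r) ℂ :=
  fun i j => if vecNorm (Z i) ≤ τ then Z i j else ((τ / vecNorm (Z i) : ℝ) : ℂ) * Z i j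

section MatrixNorms

open scoped Matrix.Norms.L2Operator

variable {m n k : ℕ}

lemma vecNorm_eq_norm (v : Fin n → ℂ) : vecNorm v = ‖WithLp.toLp 2 v‖ := by
  rw [vecNorm, EuclideanSpace.norm_eq]

lemma vecNorm_nonneg (v : Fin n → ℂ) : 0 ≤ vecNorm v := Real.sqrt_nonneg _

lemma vecNorm_sq (v : Fin n → ℂ) : vecNorm v ^ 2 = ∑ i, ‖v i‖ ^ 2 :=
  Real.sq_sqrt (Finset.sum_nonneg fun _ _ => by positivity)

lemma vecNorm_add_le (v w : Fin n → ℂ) : vecNorm (v + w) ≤ vecNorm v + vecNorm w := by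
  simpa only [vecNorm_eq_norm, WithLp.toLp_add] using norm_add_le _ _

lemma vecNorm_sub_le (v w : Fin n → ℂ) : vecNorm v - vecNorm w ≤ vecNorm (v - w) := by
  simpa only [vecNorm_eq_norm, WithLp.toLp_sub] using norm_sub_norm_le _ _

lemma vecNorm_smul (c : ℂ) (v : Fin n → ℂ) : vecNorm (c • v) = ‖c‖ * vecNorm v := by
  simp only [vecNorm_eq_norm, WithLp.toLp_smul, norm_smul]

lemma vecNorm_zero : vecNorm (0 : Fin n → ℂ) = 0 := by simp [vecNorm]

lemma vecNorm_star (v : Fin n → ℂ) : vecNorm (star v) = vecNorm v := by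
  simp [vecNorm]

lemma vecNorm_single (i : Fin n) : vecNorm (Pi.single i (1 : ℂ)) = 1 := by
  rw [vecNorm_eq_norm]
  simp

lemma vecNorm_mulVec_le (A : Matrix (Fin m) (Fin n) ℂ) (v : Fin n → ℂ) :
    vecNorm (A *ᵥ v) ≤ ‖A‖ * vecNorm v := by
  simp only [vecNorm_eq_norm]
  exact Matrix.l2_opNorm_mulVec A (WithLp.toLp 2 v)

lemma l2_opNorm_le_of_vecNorm_mulVec_le {A : Matrix (Fin m) (Fin n) ℂ} {c : ℝ} (hc : 0 ≤ c)
    (h : ∀ v, vecNorm (A *ᵥ v) ≤ c * vecNorm v) : ‖A‖ ≤ c := by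
  rw [Matrix.l2_opNorm_def]
  refine ContinuousLinearMap.opNorm_le_bound _ hc fun x => ?_
  have := h x.ofLp
  simp only [vecNorm_eq_norm] at this
  exact this

lemma specNorm_eq_norm (A : Matrix (Fin m) (Fin n) ℂ) : specNorm A = ‖A‖ := by
  have hb : ∀ t ∈ {t : ℝ | ∃ v : Fin n → ℂ, vecNorm v = 1 ∧ t = vecNorm (A.mulVec v)},
      t ≤ ‖A‖ := by
    rintro t ⟨v, hv, rfl⟩
    simpa [hv] using vecNorm_mulVec_le A v
  apply le_antisymm
  · exact Real.sSup_le hb (norm_nonneg _)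
  · have h0 : 0 ≤ specNorm A := by
      apply Real.sSup_nonneg
      rintro t ⟨v, -, rfl⟩
      exact vecNorm_nonneg _
    refine l2_opNorm_le_of_vecNorm_mulVec_le h0 fun v => ?_
    rcases eq_or_lt_of_le (vecNorm_nonneg v) with h | h
    · have := vecNorm_mulVec_le A v
      rw [← h] at this ⊢
      simpa using this
    · have hmem : vecNorm (A *ᵥ ((((vecNorm v)⁻¹ : ℝ) : ℂ) • v)) ≤ specNorm A := by
        refine le_csSup ⟨‖A‖, hb⟩ ⟨_, ?_, rfl⟩
        rw [vecNorm_smul, Complex.norm_real, Real.norm_of_nonneg (by positivity)]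
        exact inv_mul_cancel₀ h.ne'
      rw [Matrix.mulVec_smul, vecNorm_smul, Complex.norm_real,
        Real.norm_of_nonneg (by positivity), inv_mul_le_iff₀ h] at hmem
      linarith

lemma le_sigmaMin {A : Matrix (Fin m) (Fin n) ℂ} (hn : 0 < n) {c : ℝ}
    (h : ∀ v, c * vecNorm v ≤ vecNorm (A *ᵥ v)) : c ≤ sigmaMin A := by
  refine le_csInf ⟨_, Pi.single ⟨0, hn⟩ 1, vecNorm_single _, rfl⟩ ?_
  rintro t ⟨v, hv, rfl⟩
  simpa [hv] using h v

lemma l2_opNorm_transpose (A : Matrix (Fin m) (Fin n) ℂ) : ‖Aᵀ‖ = ‖A‖ := by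
  have key : ∀ {m n : ℕ} (B : Matrix (Fin m) (Fin n) ℂ), ‖Bᵀ‖ ≤ ‖B‖ := by
    intro m n B
    rw [← Matrix.l2_opNorm_conjTranspose]
    refine l2_opNorm_le_of_vecNorm_mulVec_le (norm_nonneg _) fun v => ?_
    have : Bᵀᴴ *ᵥ v = star (B *ᵥ star v) := by
      rw [Matrix.star_mulVec, star_star, ← Matrix.mulVec_transpose]
      rfl
    rw [this, vecNorm_star, ← vecNorm_star v]
    exact vecNorm_mulVec_le _ _
  exact le_antisymm (key A) (key Aᵀ)

lemma l2_opNorm_le_one_of_conjTranspose_mul_self {U : Matrix (Fin m) (Fin n) ℂ}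
    (hU : Uᴴ * U = 1) : ‖U‖ ≤ 1 := by
  have h1 : ‖(1 : Matrix (Fin n) (Fin n) ℂ)‖ ≤ 1 :=
    l2_opNorm_le_of_vecNorm_mulVec_le zero_le_one fun v => by simp
  have := Matrix.l2_opNorm_conjTranspose_mul_self U
  rw [hU] at this
  nlinarith [norm_nonneg U]

lemma vecNorm_mulVec_of_conjTranspose_mul_self {U : Matrix (Fin m) (Fin n) ℂ}
    (hU : Uᴴ * U = 1) (v : Fin n → ℂ) : vecNorm (U *ᵥ v) = vecNorm v := by
  have h1 := l2_opNorm_le_one_of_conjTranspose_mul_self hU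
  apply le_antisymm
  · have := vecNorm_mulVec_le U v
    nlinarith [vecNorm_nonneg v]
  · have := vecNorm_mulVec_le Uᴴ (U *ᵥ v)
    rw [Matrix.mulVec_mulVec, hU, Matrix.one_mulVec, Matrix.l2_opNorm_conjTranspose] at this
    nlinarith [vecNorm_nonneg (U *ᵥ v)]

lemma l2_opNorm_one_sub_le_one {U : Matrix (Fin m) (Fin n) ℂ} (hU : Uᴴ * U = 1) :
    ‖1 - U * Uᴴ‖ ≤ 1 := by
  have h : (1 - U * Uᴴ)ᴴ * (1 - U * Uᴴ) = 1 - U * Uᴴ := by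
    have hp : U * Uᴴ * (U * Uᴴ) = U * Uᴴ := by
      rw [Matrix.mul_assoc, ← Matrix.mul_assoc Uᴴ, hU, Matrix.one_mul]
    simp [Matrix.mul_sub, Matrix.sub_mul, hp]
  have := Matrix.l2_opNorm_conjTranspose_mul_self (1 - U * Uᴴ)
  rw [h] at this
  by_contra! hc
  nlinarith [norm_nonneg (1 - U * Uᴴ)]

lemma l2_opNorm_diagonal_le {d : Fin n → ℂ} {c : ℝ} (hc : 0 ≤ c) (h : ∀ i, ‖d i‖ ≤ c) :
    ‖Matrix.diagonal d‖ ≤ c := by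
  rw [Matrix.l2_opNorm_diagonal]
  exact (pi_norm_le_iff_of_nonneg hc).2 h

lemma le_vecNorm_diagonal_mulVec {d : Fin n → ℂ} {c : ℝ} (hc : 0 ≤ c) (h : ∀ i, c ≤ ‖d i‖)
    (v : Fin n → ℂ) : c * vecNorm v ≤ vecNorm (Matrix.diagonal d *ᵥ v) := by
  rw [vecNorm, vecNorm, ← Real.sqrt_sq hc, ← Real.sqrt_mul (sq_nonneg c)]
  apply Real.sqrt_le_sqrt
  rw [Finset.mul_sum]
  refine Finset.sum_le_sum fun i _ => ?_
  rw [Matrix.mulVec_diagonal, norm_mul, mul_pow]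
  gcongr
  exact h i

lemma isUnit_of_le_vecNorm_mulVec {A : Matrix (Fin n) (Fin n) ℂ} {c : ℝ} (hc : 0 < c)
    (h : ∀ v, c * vecNorm v ≤ vecNorm (A *ᵥ v)) : IsUnit A := by
  rw [← Matrix.mulVec_injective_iff_isUnit]
  intro v w hvw
  have h1 := h (v - w)
  rw [Matrix.mulVec_sub, sub_eq_zero.2 hvw, vecNorm_zero, vecNorm_eq_norm] at h1
  have h2 : ‖WithLp.toLp 2 (v - w)‖ = 0 :=
    le_antisymm (by_contra fun hne => by nlinarith [not_le.1 hne]) (norm_nonneg _)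
  rw [norm_eq_zero, WithLp.toLp_eq_zero] at h2
  exact sub_eq_zero.1 h2

lemma l2_opNorm_inv_le {A : Matrix (Fin n) (Fin n) ℂ} {c : ℝ} (hc : 0 < c)
    (h : ∀ v, c * vecNorm v ≤ vecNorm (A *ᵥ v)) : ‖A⁻¹‖ ≤ c⁻¹ := by
  have hA := isUnit_of_le_vecNorm_mulVec hc h
  refine l2_opNorm_le_of_vecNorm_mulVec_le (by positivity) fun v => ?_
  have := h (A⁻¹ *ᵥ v)
  rw [Matrix.mulVec_mulVec, Matrix.mul_nonsing_inv _ ((Matrix.isUnit_iff_isUnit_det A).1 hA),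
    Matrix.one_mulVec] at this
  rw [inv_mul_eq_div, le_div_iff₀ hc]
  linarith

lemma vecNorm_row_mul_le (A : Matrix (Fin m) (Fin n) ℂ) (B : Matrix (Fin n) (Fin k) ℂ)
    (i : Fin m) : vecNorm ((A * B) i) ≤ vecNorm (A i) * ‖B‖ := by
  have h : (A * B) i = Bᵀ *ᵥ (A i) := by
    rw [Matrix.mulVec_transpose, Matrix.mul_apply_eq_vecMul]
  rw [h, mul_comm, ← l2_opNorm_transpose B]
  exact vecNorm_mulVec_le _ _

lemma norm_apply_le_vecNorm (v : Fin n → ℂ) (i : Fin n) : ‖v i‖ ≤ vecNorm v := by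
  apply Real.le_sqrt_of_sq_le
  exact Finset.single_le_sum (f := fun i => ‖v i‖ ^ 2) (fun _ _ => by positivity)
    (Finset.mem_univ i)

lemma vecNorm_row_le_norm2inf (A : Matrix (Fin m) (Fin n) ℂ) (i : Fin m) :
    vecNorm (A i) ≤ norm2inf A :=
  le_ciSup (f := fun i => vecNorm (A i)) (Set.finite_range _).bddAbove i

lemma frobNorm_eq_norm (A : Matrix (Fin m) (Fin n) ℂ) :
    frobNorm A = ‖WithLp.toLp 2 (fun p : Fin m × Fin n => A p.1 p.2)‖ := by
  rw [frobNorm, EuclideanSpace.norm_eq, Fintype.sum_prod_type]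

lemma frobNorm_nonneg (A : Matrix (Fin m) (Fin n) ℂ) : 0 ≤ frobNorm A := Real.sqrt_nonneg _

lemma frobNorm_add_le (A B : Matrix (Fin m) (Fin n) ℂ) :
    frobNorm (A + B) ≤ frobNorm A + frobNorm B := by
  simp only [frobNorm_eq_norm]
  exact norm_add_le (WithLp.toLp 2 fun p : Fin m × Fin n => A p.1 p.2)
    (WithLp.toLp 2 fun p : Fin m × Fin n => B p.1 p.2)

lemma frobNorm_sq_eq_sum_rows (A : Matrix (Fin m) (Fin n) ℂ) :
    frobNorm A ^ 2 = ∑ i, vecNorm (A i) ^ 2 := by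
  rw [frobNorm, Real.sq_sqrt (Finset.sum_nonneg fun _ _ => by positivity)]
  simp_rw [vecNorm_sq]

lemma l2_opNorm_le_frobNorm (A : Matrix (Fin m) (Fin n) ℂ) : ‖A‖ ≤ frobNorm A := by
  refine l2_opNorm_le_of_vecNorm_mulVec_le (frobNorm_nonneg _) fun v => ?_
  rw [← sq_le_sq₀ (vecNorm_nonneg _) (mul_nonneg (frobNorm_nonneg _) (vecNorm_nonneg _)),
    mul_pow, frobNorm_sq_eq_sum_rows, Finset.sum_mul, vecNorm_sq]
  refine Finset.sum_le_sum fun i _ => ?_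
  rw [vecNorm_sq, vecNorm_sq]
  calc ‖(A *ᵥ v) i‖ ^ 2 ≤ (∑ j, ‖A i j‖ * ‖v j‖) ^ 2 := by
        gcongr
        refine (norm_sum_le Finset.univ fun j => A i j * v j).trans_eq ?_
        simp only [norm_mul]
    _ ≤ _ := Finset.sum_mul_sq_le_sq_mul_sq _ _ _

lemma frobNorm_le_sqrt_mul_l2_opNorm (A : Matrix (Fin m) (Fin n) ℂ) :
    frobNorm A ≤ Real.sqrt n * ‖A‖ := by
  rw [← sq_le_sq₀ (frobNorm_nonneg _) (by positivity), mul_pow, Real.sq_sqrt (by positivity),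
    frobNorm, Real.sq_sqrt (Finset.sum_nonneg fun _ _ => by positivity), Finset.sum_comm]
  calc _ ≤ ∑ j : Fin n, ‖A‖ ^ 2 := by
        refine Finset.sum_le_sum fun j _ => ?_
        have := vecNorm_mulVec_le A (Pi.single j 1)
        rw [vecNorm_single, mul_one, Matrix.mulVec_single_one] at this
        calc _ = vecNorm (A.col j) ^ 2 := by rw [vecNorm_sq]; rfl
          _ ≤ _ := by gcongr; exact vecNorm_nonneg _
    _ = _ := by simp

end MatrixNorms

section Alignment

open scoped Matrix.Norms.L2Operator

variable {n ns r : ℕ}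

/-- The complex diagonal matrix with prescribed real diagonal entries. -/
def realDiagonal (f : Fin n → ℝ) : Matrix (Fin n) (Fin n) ℂ :=
  Matrix.diagonal fun k => (f k : ℂ)

lemma realDiagonal_mul (f g : Fin n → ℝ) :
    realDiagonal f * realDiagonal g = realDiagonal fun k => f k * g k := by
  simp [realDiagonal]

lemma realDiagonal_transpose (f : Fin n → ℝ) : (realDiagonal f)ᵀ = realDiagonal f := by
  simp [realDiagonal]

lemma realDiagonal_conjTranspose (f : Fin n → ℝ) : (realDiagonal f)ᴴ = realDiagonal f := by
  simp only [realDiagonal, Matrix.diagonal_conjTranspose]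
  congr 1
  ext k
  simp

lemma realDiagonal_eq_one {f : Fin n → ℝ} (h : ∀ k, f k = 1) : realDiagonal f = 1 := by
  simp [realDiagonal, h]

lemma l2_opNorm_realDiagonal_le {f : Fin n → ℝ} {c : ℝ} (hc : 0 ≤ c) (h : ∀ k, |f k| ≤ c) :
    ‖realDiagonal f‖ ≤ c :=
  l2_opNorm_diagonal_le hc fun k => by simpa using h k

lemma le_vecNorm_realDiagonal_mulVec {f : Fin n → ℝ} {c : ℝ} (hc : 0 ≤ c) (h : ∀ k, c ≤ f k)
    (v : Fin n → ℂ) : c * vecNorm v ≤ vecNorm (realDiagonal f *ᵥ v) :=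
  le_vecNorm_diagonal_mulVec hc (fun k => by simpa using (h k).trans (le_abs_self _)) v

lemma transpose_mul_transpose_conjTranspose {U : Matrix (Fin ns) (Fin r) ℂ}
    (hU : Uᴴ * U = 1) : Uᵀ * Uᵀᴴ = 1 := by
  have := congrArg Matrix.transpose hU
  rw [Matrix.transpose_mul, Matrix.transpose_one] at this
  exact this

lemma vecNorm_transpose_conjTranspose_mulVec {U : Matrix (Fin ns) (Fin r) ℂ}
    (hU : Uᴴ * U = 1) (v : Fin r → ℂ) : vecNorm (Uᵀᴴ *ᵥ v) = vecNorm v :=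
  vecNorm_mulVec_of_conjTranspose_mul_self
    (by rw [Matrix.conjTranspose_conjTranspose]; exact transpose_mul_transpose_conjTranspose hU) v

lemma mul_three_norm_le {a b c d : ℕ} (A : Matrix (Fin a) (Fin b) ℂ)
    (B : Matrix (Fin b) (Fin c) ℂ) (C : Matrix (Fin c) (Fin d) ℂ) {x y z : ℝ}
    (hA : ‖A‖ ≤ x) (hB : ‖B‖ ≤ y) (hC : ‖C‖ ≤ z) : ‖A * B * C‖ ≤ x * y * z := by
  have hx := (norm_nonneg A).trans hA
  have hy := (norm_nonneg B).trans hB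
  calc ‖A * B * C‖ ≤ ‖A * B‖ * ‖C‖ := Matrix.l2_opNorm_mul _ _
    _ ≤ ‖A‖ * ‖B‖ * ‖C‖ := by gcongr; exact Matrix.l2_opNorm_mul _ _
    _ ≤ _ := by gcongr

variable {U U0 : Matrix (Fin ns) (Fin r) ℂ} {s s0 : Fin r → ℝ} {σr δ : ℝ}

/-- A Wedin-type bound: the row spaces of the two matrices are nearly aligned. -/
lemma le_vecNorm_overlap_mulVec (hU : Uᴴ * U = 1) (hU0 : U0ᴴ * U0 = 1) (hσ : 0 < σr)
    (hs : ∀ k, σr ≤ s k)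
    (hδ : ‖U0 * realDiagonal s0 * U0ᵀ - U * realDiagonal s * Uᵀ‖ ≤ δ) (v : Fin r → ℂ) :
    (1 - δ / σr) * vecNorm v ≤ vecNorm ((U0ᵀ * Uᵀᴴ) *ᵥ v) := by
  have hV0 := transpose_mul_transpose_conjTranspose hU0
  have hV := transpose_mul_transpose_conjTranspose hU
  have hspos : ∀ k, 0 < s k := fun k => hσ.trans_le (hs k)
  set Q := 1 - U0ᵀᴴ * U0ᵀ with hQ
  have hQn : ‖Q‖ ≤ 1 := by
    have := l2_opNorm_one_sub_le_one (U := U0ᵀᴴ)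
      (by rw [Matrix.conjTranspose_conjTranspose]; exact hV0)
    rwa [Matrix.conjTranspose_conjTranspose] at this
  have hQV0 : Q * U0ᵀᴴ = 0 := by
    rw [hQ, Matrix.sub_mul, Matrix.mul_assoc, hV0]
    simp
  have e1 : (U * realDiagonal s * Uᵀ)ᴴ * (U * realDiagonal fun k => (s k)⁻¹) = Uᵀᴴ := by
    have : realDiagonal s * (realDiagonal fun k => (s k)⁻¹) = 1 := by
      rw [realDiagonal_mul]
      exact realDiagonal_eq_one fun k => mul_inv_cancel₀ (hspos k).ne'
    simp only [Matrix.conjTranspose_mul, realDiagonal_conjTranspose]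
    calc _ = Uᵀᴴ * realDiagonal s * (Uᴴ * U) * realDiagonal fun k => (s k)⁻¹ := by
          simp only [Matrix.mul_assoc]
      _ = _ := by rw [hU, Matrix.mul_one, Matrix.mul_assoc, this, Matrix.mul_one]
  have e2 : Q * (U0 * realDiagonal s0 * U0ᵀ)ᴴ = 0 := by
    simp only [Matrix.conjTranspose_mul]
    rw [← Matrix.mul_assoc, hQV0, Matrix.zero_mul]
  have e3 : Q * Uᵀᴴ = -(Q * (U0 * realDiagonal s0 * U0ᵀ - U * realDiagonal s * Uᵀ)ᴴ *
      (U * realDiagonal fun k => (s k)⁻¹)) := by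
    rw [Matrix.conjTranspose_sub, Matrix.mul_sub, e2, zero_sub, Matrix.neg_mul, neg_neg,
      Matrix.mul_assoc, e1]
  have hUd : ‖U * realDiagonal fun k => (s k)⁻¹‖ ≤ 1 * σr⁻¹ := by
    refine (Matrix.l2_opNorm_mul _ _).trans ?_
    gcongr
    · exact l2_opNorm_le_one_of_conjTranspose_mul_self hU
    · refine l2_opNorm_realDiagonal_le (by positivity) fun k => ?_
      rw [abs_of_pos (inv_pos.2 (hspos k))]
      exact inv_anti₀ hσ (hs k)
  have hQV : ‖Q * Uᵀᴴ‖ ≤ δ / σr := by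
    rw [e3, norm_neg]
    refine (mul_three_norm_le _ _ _ hQn
      ((Matrix.l2_opNorm_conjTranspose _).trans_le hδ) hUd).trans_eq ?_
    rw [div_eq_mul_inv]
    ring
  have hV1 : vecNorm (Uᵀᴴ *ᵥ v) = vecNorm v :=
    vecNorm_transpose_conjTranspose_mulVec hU v
  have hV2 : vecNorm (U0ᵀᴴ *ᵥ ((U0ᵀ * Uᵀᴴ) *ᵥ v)) = vecNorm ((U0ᵀ * Uᵀᴴ) *ᵥ v) :=
    vecNorm_transpose_conjTranspose_mulVec hU0 _
  have hdec : Uᵀᴴ *ᵥ v = U0ᵀᴴ *ᵥ ((U0ᵀ * Uᵀᴴ) *ᵥ v) + (Q * Uᵀᴴ) *ᵥ v := by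
    rw [Matrix.mulVec_mulVec, ← Matrix.add_mulVec, hQ, Matrix.sub_mul, Matrix.one_mul,
      ← Matrix.mul_assoc, add_sub_cancel]
  have h1 := vecNorm_add_le (U0ᵀᴴ *ᵥ ((U0ᵀ * Uᵀᴴ) *ᵥ v)) ((Q * Uᵀᴴ) *ᵥ v)
  rw [← hdec, hV1, hV2] at h1
  have h2 := (vecNorm_mulVec_le (Q * Uᵀᴴ) v).trans
    (mul_le_mul_of_nonneg_right hQV (vecNorm_nonneg v))
  linarith

/-- A Weyl-type bound: the smallest diagonal entry is stable under perturbation. -/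
lemma sub_le_of_perturbation (hU : Uᴴ * U = 1) (hU0 : U0ᴴ * U0 = 1) (hσ : 0 < σr)
    (hs : ∀ k, σr ≤ s k) (hs0 : ∀ k, 0 ≤ s0 k)
    (hδ : ‖U0 * realDiagonal s0 * U0ᵀ - U * realDiagonal s * Uᵀ‖ ≤ δ) (hδσ : δ < σr)
    (k : Fin r) : σr - δ ≤ s0 k := by
  have hV0 := transpose_mul_transpose_conjTranspose hU0
  have hV := transpose_mul_transpose_conjTranspose hU
  have hW := le_vecNorm_overlap_mulVec hU hU0 hσ hs hδ
  have hWu := isUnit_of_le_vecNorm_mulVec (by rw [sub_pos, div_lt_one hσ]; exact hδσ) hW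
  set W := U0ᵀ * Uᵀᴴ with hWdef
  set v := W⁻¹ *ᵥ Pi.single k (1 : ℂ) with hv
  have hWv : W *ᵥ v = Pi.single k 1 := by
    rw [hv, Matrix.mulVec_mulVec,
      Matrix.mul_nonsing_inv _ ((Matrix.isUnit_iff_isUnit_det W).1 hWu), Matrix.one_mulVec]
  have hVn : ‖Uᵀᴴ‖ ≤ 1 := l2_opNorm_le_one_of_conjTranspose_mul_self
    (by rw [Matrix.conjTranspose_conjTranspose]; exact hV)
  have hWn : ‖W‖ ≤ 1 := by
    refine (Matrix.l2_opNorm_mul _ _).trans ?_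
    have : ‖U0ᵀ‖ ≤ 1 := by
      rw [l2_opNorm_transpose]; exact l2_opNorm_le_one_of_conjTranspose_mul_self hU0
    nlinarith [norm_nonneg U0ᵀ, norm_nonneg Uᵀᴴ]
  have hv1 : 1 ≤ vecNorm v := by
    have := vecNorm_mulVec_le W v
    rw [hWv, vecNorm_single] at this
    nlinarith [vecNorm_nonneg v]
  have h0 : vecNorm ((U0 * realDiagonal s0 * U0ᵀ) *ᵥ (Uᵀᴴ *ᵥ v)) = s0 k := by
    rw [Matrix.mulVec_mulVec, Matrix.mul_assoc, ← hWdef, ← Matrix.mulVec_mulVec, hWv,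
      ← Matrix.mulVec_mulVec, vecNorm_mulVec_of_conjTranspose_mul_self hU0]
    have : realDiagonal s0 *ᵥ Pi.single k 1 = (s0 k : ℂ) • Pi.single k 1 := by
      ext i
      rw [realDiagonal, Matrix.mulVec_diagonal]
      by_cases h : i = k
      · subst h; simp
      · simp [h]
    rw [this, vecNorm_smul, vecNorm_single, mul_one, Complex.norm_real,
      Real.norm_of_nonneg (hs0 k)]
  have h1 : σr * vecNorm v ≤ vecNorm ((U * realDiagonal s * Uᵀ) *ᵥ (Uᵀᴴ *ᵥ v)) := by
    rw [Matrix.mulVec_mulVec, Matrix.mul_assoc, hV, Matrix.mul_one, ← Matrix.mulVec_mulVec,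
      vecNorm_mulVec_of_conjTranspose_mul_self hU]
    exact le_vecNorm_realDiagonal_mulVec hσ.le hs v
  have h2 := vecNorm_sub_le ((U * realDiagonal s * Uᵀ) *ᵥ (Uᵀᴴ *ᵥ v))
    ((U0 * realDiagonal s0 * U0ᵀ) *ᵥ (Uᵀᴴ *ᵥ v))
  rw [← Matrix.sub_mulVec, h0] at h2
  have h3 := vecNorm_mulVec_le (U * realDiagonal s * Uᵀ - U0 * realDiagonal s0 * U0ᵀ) (Uᵀᴴ *ᵥ v)
  rw [norm_sub_rev, vecNorm_transpose_conjTranspose_mulVec hU] at h3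
  have h4 := mul_le_mul_of_nonneg_right hδ (vecNorm_nonneg v)
  nlinarith

lemma le_l2_opNorm_diag (hU0 : U0ᴴ * U0 = 1) (k : Fin r) :
    |s0 k| ≤ ‖U0 * realDiagonal s0 * U0ᵀ‖ := by
  have hV0 := transpose_mul_transpose_conjTranspose hU0
  have h := vecNorm_mulVec_le (U0 * realDiagonal s0 * U0ᵀ) (U0ᵀᴴ *ᵥ Pi.single k 1)
  rw [vecNorm_transpose_conjTranspose_mulVec hU0, vecNorm_single,
    Matrix.mulVec_mulVec, Matrix.mul_assoc, hV0, Matrix.mul_one, ← Matrix.mulVec_mulVec,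
    vecNorm_mulVec_of_conjTranspose_mul_self hU0] at h
  refine le_trans ?_ (h.trans_eq (mul_one _))
  refine le_trans ?_ (norm_apply_le_vecNorm _ k)
  rw [realDiagonal, Matrix.mulVec_diagonal]
  simp

lemma l2_opNorm_le_diag (hU0 : U0ᴴ * U0 = 1) {c : ℝ} (hc : 0 ≤ c) (h : ∀ k, |s0 k| ≤ c) :
    ‖U0 * realDiagonal s0‖ ≤ c := by
  have := l2_opNorm_le_one_of_conjTranspose_mul_self hU0
  refine (Matrix.l2_opNorm_mul _ _).trans ?_
  nlinarith [l2_opNorm_realDiagonal_le hc h, norm_nonneg (realDiagonal s0), norm_nonneg U0]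

lemma exists_alignment (hU : Uᴴ * U = 1) (hU0 : U0ᴴ * U0 = 1) (hσ : 0 < σr)
    (hs : ∀ k, σr ≤ s k) (hs0 : ∀ k, 0 ≤ s0 k)
    (hδ : ‖U0 * realDiagonal s0 * U0ᵀ - U * realDiagonal s * Uᵀ‖ ≤ δ) (hδσ : δ ≤ σr / 100) :
    ∃ P : Matrix (Fin r) (Fin r) ℂ, IsUnit P ∧
      ‖U0 * realDiagonal (fun k => √(s0 k)) - U * realDiagonal (fun k => √(s k)) * P‖
        ≤ 2 * δ / √σr ∧
      ‖U * realDiagonal (fun k => √(s k)) * P - U * realDiagonal (fun k => √(s k)) * (P⁻¹)ᵀ‖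
        ≤ 2 * δ / √σr ∧
      ∀ i, vecNorm ((U * realDiagonal (fun k => √(s k)) * P) i)
          ≤ vecNorm (U i) * √‖U0 * realDiagonal s0 * U0ᵀ‖ ∧
        vecNorm ((U * realDiagonal (fun k => √(s k)) * (P⁻¹)ᵀ) i)
          ≤ vecNorm (U i) * (√‖U0 * realDiagonal s0 * U0ᵀ‖ + 2 * δ / √σr) := by
  have hδ0 : 0 ≤ δ := (norm_nonneg _).trans hδ
  have hV0 := transpose_mul_transpose_conjTranspose hU0
  have hV := transpose_mul_transpose_conjTranspose hU
  have hspos : ∀ k, 0 < s k := fun k => hσ.trans_le (hs k)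
  have hs0' := sub_le_of_perturbation hU hU0 hσ hs hs0 hδ (by linarith)
  have hs0pos : ∀ k, 0 < s0 k := fun k => by have := hs0' k; linarith
  have hW := le_vecNorm_overlap_mulVec hU hU0 hσ hs hδ
  have hσs : 0 < √σr := Real.sqrt_pos.2 hσ
  have hsq : √σr * √σr = σr := Real.mul_self_sqrt hσ.le
  have hs0r : ∀ k, 0.9 * √σr ≤ √(s0 k) := fun k => by
    apply Real.le_sqrt_of_sq_le
    have := hs0' k
    nlinarith
  set M0 := U0 * realDiagonal s0 * U0ᵀ with hM0
  set M := U * realDiagonal s * Uᵀ with hM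
  set S := realDiagonal (fun k => √(s0 k)) with hS
  set D := realDiagonal (fun k => √(s k)) with hD
  set Di := realDiagonal (fun k => (√(s k))⁻¹) with hDi
  have hSS : S * S = realDiagonal s0 := by
    rw [hS, realDiagonal_mul]
    congr 1
    ext k
    exact Real.mul_self_sqrt (hs0 k)
  have hDD : D * D = realDiagonal s := by
    rw [hD, realDiagonal_mul]
    congr 1
    ext k
    exact Real.mul_self_sqrt (hspos k).le
  have hDDi : D * Di = 1 := by
    rw [hD, hDi, realDiagonal_mul]
    exact realDiagonal_eq_one fun k => mul_inv_cancel₀ (Real.sqrt_pos.2 (hspos k)).ne'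
  have hDiD : Di * D = 1 := mul_eq_one_comm.1 hDDi
  -- the overlap factor
  set G := Uᴴ * U0 * S with hG
  have hGT : Gᵀ = S * (U0ᵀ * Uᵀᴴ) := by
    rw [hG, Matrix.transpose_mul, Matrix.transpose_mul, hS, realDiagonal_transpose]
    rfl
  have hGlow : ∀ v, (√σr / 2) * vecNorm v ≤ vecNorm (Gᵀ *ᵥ v) := fun v => by
    have h1 : 0.9 * √σr * vecNorm ((U0ᵀ * Uᵀᴴ) *ᵥ v) ≤ vecNorm (Gᵀ *ᵥ v) := by
      rw [hGT, ← Matrix.mulVec_mulVec v S]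
      exact le_vecNorm_realDiagonal_mulVec (by positivity) hs0r _
    have h2 := hW v
    have h3 : δ / σr ≤ 1 / 100 := by rw [div_le_iff₀ hσ]; linarith
    have h4 : 0.99 * vecNorm v ≤ vecNorm ((U0ᵀ * Uᵀᴴ) *ᵥ v) := by
      nlinarith [vecNorm_nonneg v]
    nlinarith [mul_le_mul_of_nonneg_left h4 hσs.le, mul_nonneg hσs.le (vecNorm_nonneg v)]
  have hGTu : IsUnit Gᵀ := isUnit_of_le_vecNorm_mulVec (by positivity) hGlow
  have hGTi : ‖(Gᵀ)⁻¹‖ ≤ 2 / √σr :=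
    (l2_opNorm_inv_le (by positivity) hGlow).trans_eq (inv_div _ _)
  have hGu : IsUnit G := by
    rw [Matrix.isUnit_iff_isUnit_det] at hGTu ⊢
    rwa [Matrix.det_transpose] at hGTu
  have hGTd := (Matrix.isUnit_iff_isUnit_det _).1 hGTu
  have hPu : IsUnit (Di * G) :=
    IsUnit.mul ⟨⟨Di, D, hDiD, hDDi⟩, rfl⟩ hGu
  have hPit : ((Di * G)⁻¹)ᵀ = D * (Gᵀ)⁻¹ := by
    rw [Matrix.transpose_nonsing_inv, Matrix.transpose_mul, hDi, realDiagonal_transpose, ← hDi]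
    apply Matrix.inv_eq_right_inv
    rw [Matrix.mul_assoc, ← Matrix.mul_assoc Di, hDiD, Matrix.one_mul,
      Matrix.mul_nonsing_inv _ hGTd]
  have hZP : U * D * (Di * G) = U * G := by
    rw [Matrix.mul_assoc, ← Matrix.mul_assoc D, hDDi, Matrix.one_mul]
  have hZQ : U * D * (D * (Gᵀ)⁻¹) = U * (realDiagonal s * (Gᵀ)⁻¹) := by
    rw [Matrix.mul_assoc, ← Matrix.mul_assoc D, hDD]
  have hGG : G * Gᵀ = Uᴴ * M0 * Uᵀᴴ := by
    rw [hGT, hG, hM0, ← hSS]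
    simp only [Matrix.mul_assoc]
  have hSig : realDiagonal s = Uᴴ * M * Uᵀᴴ := by
    calc realDiagonal s = (Uᴴ * U) * realDiagonal s * (Uᵀ * Uᵀᴴ) := by
          rw [hU, hV, Matrix.one_mul, Matrix.mul_one]
      _ = _ := by rw [hM]; simp only [Matrix.mul_assoc]
  have hUn := l2_opNorm_le_one_of_conjTranspose_mul_self hU
  have hVn : ‖Uᵀᴴ‖ ≤ 1 := by
    rwa [Matrix.l2_opNorm_conjTranspose, l2_opNorm_transpose]
  have hUHn : ‖Uᴴ‖ ≤ 1 := by
    rwa [Matrix.l2_opNorm_conjTranspose]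
  have hE : ‖Uᴴ * (M0 - M) * Uᵀᴴ * (Gᵀ)⁻¹‖ ≤ 2 * δ / √σr := by
    refine (Matrix.l2_opNorm_mul _ _).trans ?_
    have h1 := mul_three_norm_le _ _ _ hUHn hδ hVn
    calc _ ≤ (1 * δ * 1) * (2 / √σr) := by gcongr
      _ = _ := by ring
  have hdiff : U * G - U * (realDiagonal s * (Gᵀ)⁻¹)
      = U * (Uᴴ * (M0 - M) * Uᵀᴴ * (Gᵀ)⁻¹) := by
    rw [Matrix.mul_sub Uᴴ, Matrix.sub_mul, ← hGG, ← hSig, Matrix.sub_mul, Matrix.mul_assoc G,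
      Matrix.mul_nonsing_inv _ hGTd, Matrix.mul_one, Matrix.mul_sub]
  have hGn : ‖G‖ ≤ √‖M0‖ := by
    rw [hG, Matrix.mul_assoc]
    refine (Matrix.l2_opNorm_mul _ _).trans ?_
    have h1 : ‖U0 * S‖ ≤ √‖M0‖ := by
      refine l2_opNorm_le_diag hU0 (Real.sqrt_nonneg _) fun k => ?_
      rw [abs_of_nonneg (Real.sqrt_nonneg _)]
      exact Real.sqrt_le_sqrt ((le_abs_self _).trans (le_l2_opNorm_diag hU0 k))
    nlinarith [norm_nonneg (U0 * S), norm_nonneg Uᴴ]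
  refine ⟨Di * G, hPu, ?_, ?_, fun i => ⟨?_, ?_⟩⟩
  · rw [hZP]
    have hQ := l2_opNorm_one_sub_le_one hU
    have e1 : (1 - U * Uᴴ) * M = 0 := by
      have : (1 - U * Uᴴ) * U = 0 := by
        rw [Matrix.sub_mul, Matrix.mul_assoc U, hU]
        simp
      rw [hM, ← Matrix.mul_assoc, ← Matrix.mul_assoc, this, Matrix.zero_mul, Matrix.zero_mul]
    have e2 : M0 * (U0ᵀᴴ * realDiagonal fun k => (√(s0 k))⁻¹) = U0 * S := by
      rw [hM0, Matrix.mul_assoc, ← Matrix.mul_assoc U0ᵀ, hV0, Matrix.one_mul, Matrix.mul_assoc,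
        realDiagonal_mul]
      congr 2
      ext k
      have := (Real.sqrt_pos.2 (hs0pos k)).ne'
      rw [← div_eq_mul_inv, Real.div_sqrt]
    have e3 : U0 * S - U * G
        = (1 - U * Uᴴ) * (M0 - M) * (U0ᵀᴴ * realDiagonal fun k => (√(s0 k))⁻¹) := by
      rw [Matrix.mul_sub, e1, sub_zero, Matrix.mul_assoc, e2, Matrix.sub_mul, Matrix.one_mul, hG]
      simp only [Matrix.mul_assoc]
    rw [e3]
    have h5 : ‖U0ᵀᴴ * realDiagonal fun k => (√(s0 k))⁻¹‖ ≤ 2 / √σr := by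
      refine l2_opNorm_le_diag (by rw [Matrix.conjTranspose_conjTranspose]; exact hV0)
        (by positivity) fun k => ?_
      rw [abs_of_nonneg (by positivity), inv_eq_one_div, div_le_div_iff₀
        (Real.sqrt_pos.2 (hs0pos k)) hσs]
      linarith [hs0r k]
    refine (mul_three_norm_le _ _ _ hQ hδ h5).trans_eq ?_
    ring
  · rw [hPit, hZP, hZQ, hdiff]
    refine (Matrix.l2_opNorm_mul _ _).trans ?_
    nlinarith [norm_nonneg (Uᴴ * (M0 - M) * Uᵀᴴ * (Gᵀ)⁻¹), norm_nonneg U]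
  · rw [hZP]
    refine (vecNorm_row_mul_le _ _ _).trans ?_
    exact mul_le_mul_of_nonneg_left hGn (vecNorm_nonneg _)
  · rw [hPit, hZQ]
    have : U * (realDiagonal s * (Gᵀ)⁻¹) = U * (G - Uᴴ * (M0 - M) * Uᵀᴴ * (Gᵀ)⁻¹) := by
      rw [Matrix.mul_sub, ← hdiff, sub_sub_cancel]
    rw [this]
    refine (vecNorm_row_mul_le _ _ _).trans ?_
    exact mul_le_mul_of_nonneg_left ((norm_sub_le _ _).trans (add_le_add hGn hE))
      (vecNorm_nonneg _)

end Alignment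

section Attainment

open scoped Matrix.Norms.L2Operator

variable {ns r : ℕ}

lemma continuous_frobNorm {m n : ℕ} :
    Continuous (frobNorm : Matrix (Fin m) (Fin n) ℂ → ℝ) := by
  unfold frobNorm
  refine Real.continuous_sqrt.comp (continuous_finsetSum _ fun i _ =>
    continuous_finsetSum _ fun j _ => ?_)
  exact ((continuous_id.matrix_elem i j).norm).pow 2

lemma distP_le (Z Zs : Matrix (Fin ns) (Fin r) ℂ) {P : Matrix (Fin r) (Fin r) ℂ}
    (hP : IsUnit P) :
    distP Z Zs ≤ Real.sqrt (frobNorm (Z - Zs * P) ^ 2 + frobNorm (Z - Zs * (P⁻¹)ᵀ) ^ 2) := by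
  refine csInf_le ⟨0, ?_⟩ ⟨P, hP, rfl⟩
  rintro t ⟨P, -, rfl⟩
  exact Real.sqrt_nonneg _

/-- The alignment distance is attained as soon as the reference factor has a left inverse. -/
lemma exists_distP_minimizer (Z Zs : Matrix (Fin ns) (Fin r) ℂ)
    (L : Matrix (Fin r) (Fin ns) ℂ) (hL : L * Zs = 1) :
    ∃ P0 : Matrix (Fin r) (Fin r) ℂ, IsUnit P0 ∧
      Real.sqrt (frobNorm (Z - Zs * P0) ^ 2 + frobNorm (Z - Zs * (P0⁻¹)ᵀ) ^ 2)
        = distP Z Zs := by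
  set f : Matrix (Fin r) (Fin r) ℂ × Matrix (Fin r) (Fin r) ℂ → ℝ := fun x =>
    Real.sqrt (frobNorm (Z - Zs * x.1) ^ 2 + frobNorm (Z - Zs * x.2) ^ 2) with hf
  have hfc : Continuous f := by
    refine Real.continuous_sqrt.comp (((continuous_frobNorm.comp ?_).pow 2).add
      ((continuous_frobNorm.comp ?_).pow 2))
    · exact continuous_const.sub (continuous_const.matrix_mul continuous_fst)
    · exact continuous_const.sub (continuous_const.matrix_mul continuous_snd)
  set K := {x : Matrix (Fin r) (Fin r) ℂ × Matrix (Fin r) (Fin r) ℂ |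
    x.1 * x.2ᵀ = 1 ∧ f x ≤ f (1, 1)} with hK
  have hclosed : IsClosed K :=
    (isClosed_eq (continuous_fst.matrix_mul continuous_snd.matrix_transpose)
      continuous_const).inter (isClosed_le hfc continuous_const)
  have hbound : ∀ P : Matrix (Fin r) (Fin r) ℂ, ∀ t, frobNorm (Z - Zs * P) ≤ t →
      ‖P‖ ≤ ‖L‖ * (‖Z‖ + t) := by
    intro P t ht
    have h1 : P = L * (Z - (Z - Zs * P)) := by
      rw [sub_sub_cancel, ← Matrix.mul_assoc, hL, Matrix.one_mul]
    calc ‖P‖ = ‖L * (Z - (Z - Zs * P))‖ := by rw [← h1]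
      _ ≤ ‖L‖ * ‖Z - (Z - Zs * P)‖ := Matrix.l2_opNorm_mul _ _
      _ ≤ _ := by
        gcongr
        refine (norm_sub_le _ _).trans ?_
        gcongr
        exact (l2_opNorm_le_frobNorm _).trans ht
  have hbdd : Bornology.IsBounded K := by
    rw [isBounded_iff_forall_norm_le]
    refine ⟨‖L‖ * (‖Z‖ + f (1, 1)), fun x hx => ?_⟩
    rw [Prod.norm_def, max_le_iff]
    constructor
    · refine hbound _ _ (le_trans ?_ hx.2)
      exact Real.le_sqrt_of_sq_le (le_add_of_nonneg_right (sq_nonneg _))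
    · refine hbound _ _ (le_trans ?_ hx.2)
      exact Real.le_sqrt_of_sq_le (le_add_of_nonneg_left (sq_nonneg _))
  have : ProperSpace (Matrix (Fin r) (Fin r) ℂ) := FiniteDimensional.proper ℂ _
  have hcomp : IsCompact K := Metric.isCompact_of_isClosed_isBounded hclosed hbdd
  obtain ⟨x, hxK, hxmin⟩ := hcomp.exists_isMinOn ⟨(1, 1), by simp [hK]⟩ hfc.continuousOn
  have hx1 : IsUnit x.1 := ⟨⟨x.1, x.2ᵀ, hxK.1, mul_eq_one_comm.1 hxK.1⟩, rfl⟩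
  have hx2 : (x.1⁻¹)ᵀ = x.2 := by
    rw [Matrix.inv_eq_right_inv hxK.1, Matrix.transpose_transpose]
  have hmin : ∀ P : Matrix (Fin r) (Fin r) ℂ, IsUnit P → f x ≤ f (P, (P⁻¹)ᵀ) := by
    intro P hP
    by_cases hle : f (P, (P⁻¹)ᵀ) ≤ f (1, 1)
    · refine isMinOn_iff.1 hxmin _ ⟨?_, hle⟩
      rw [Matrix.transpose_transpose,
        Matrix.mul_nonsing_inv _ ((Matrix.isUnit_iff_isUnit_det P).1 hP)]
    · exact hxK.2.trans (not_le.1 hle).le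
  refine ⟨x.1, hx1, le_antisymm (le_csInf ⟨_, x.1, hx1, rfl⟩ ?_) (distP_le Z Zs hx1)⟩
  rintro t ⟨P, hP, rfl⟩
  rw [hx2]
  exact hmin P hP

end Attainment

section Clipping

lemma norm_clip_sub_le {E : Type*} [NormedAddCommGroup E] [InnerProductSpace ℂ E] {z x : E}
    {τ : ℝ} (hx : ‖x‖ ≤ τ) (hz : τ < ‖z‖) :
    ‖((τ / ‖z‖ : ℝ) : ℂ) • z - x‖ ≤ ‖z - x‖ := by
  have hτ : 0 ≤ τ := (norm_nonneg x).trans hx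
  have hz0 : 0 < ‖z‖ := hτ.trans_lt hz
  set t := τ / ‖z‖ with ht
  have ht0 : 0 ≤ t := by positivity
  have ht1 : t ≤ 1 := (div_le_one hz0).2 hz.le
  have hτt : τ = t * ‖z‖ := by rw [ht, div_mul_cancel₀ _ hz0.ne']
  rw [← sq_le_sq₀ (norm_nonneg _) (norm_nonneg _), norm_sub_sq (𝕜 := ℂ), norm_sub_sq (𝕜 := ℂ),
    norm_smul, inner_smul_left, Complex.norm_real, Real.norm_of_nonneg ht0, Complex.conj_ofReal,
    RCLike.re_eq_complex_re, Complex.re_ofReal_mul]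
  have h1 : (inner ℂ z x).re ≤ ‖z‖ * (t * ‖z‖) := by
    refine (re_inner_le_norm (𝕜 := ℂ) z x).trans ?_
    rw [← hτt]
    gcongr
  nlinarith [mul_le_mul_of_nonneg_left h1 (sub_nonneg.2 ht1), mul_nonneg (sub_nonneg.2 ht1)
    (mul_nonneg (sub_nonneg.2 ht1) (sq_nonneg ‖z‖))]

lemma frobNorm_projC_sub_le {ns r : ℕ} {τ : ℝ} {Z X : Matrix (Fin ns) (Fin r) ℂ}
    (hX : ∀ i, vecNorm (X i) ≤ τ) : frobNorm (projC τ Z - X) ≤ frobNorm (Z - X) := by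
  rw [← sq_le_sq₀ (frobNorm_nonneg _) (frobNorm_nonneg _), frobNorm_sq_eq_sum_rows,
    frobNorm_sq_eq_sum_rows]
  refine Finset.sum_le_sum fun i _ => ?_
  gcongr
  · exact vecNorm_nonneg _
  by_cases h : vecNorm (Z i) ≤ τ
  · have : (projC τ Z - X) i = (Z - X) i := by
      ext j
      simp [projC, h]
    rw [this]
  · have h1 : (projC τ Z - X) i = ((τ / vecNorm (Z i) : ℝ) : ℂ) • Z i - X i := by
      ext j
      simp [projC, h]
    have h2 : (Z - X) i = Z i - X i := rfl
    rw [h1, h2]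
    have hx := hX i
    simp only [vecNorm_eq_norm, not_le, WithLp.toLp_sub, WithLp.toLp_smul] at hx h ⊢
    exact norm_clip_sub_le hx h

end Clipping

section Deterministic

open scoped Matrix.Norms.L2Operator

set_option maxHeartbeats 800000 in
/-- If the rank-`r` matrix with factors `U0`, `s0` is spectrally close to the one with factors
`U`, `s`, then the clipped factor satisfies all initialization guarantees. -/
lemma initialization_of_close {ns r : ℕ} (hr : 1 ≤ r) {ε₀ σ1 σr δ μ₀ μ N σ : ℝ}
    (hε0 : 0 < ε₀) (hε1 : ε₀ ≤ 1 / 10)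
    {U U0 : Matrix (Fin ns) (Fin r) ℂ} {s s0 : Fin r → ℝ}
    (hU : Uᴴ * U = 1) (hU0 : U0ᴴ * U0 = 1) (hσr : 0 < σr)
    (hs : ∀ k, σr ≤ s k) (hs1 : ∀ k, s k ≤ σ1) (hs1' : ∃ k, s k = σ1) (hs0 : ∀ k, 0 ≤ s0 k)
    (hN : 0 < N) (hμ₀ : 0 < μ₀) (hμ : μ₀ ≤ μ)
    (hrow : norm2inf U ≤ √(2 * μ₀ * r / N))
    (hδ : ‖U0 * realDiagonal s0 * U0ᵀ - U * realDiagonal s * Uᵀ‖ ≤ δ)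
    (hδr : √(r : ℝ) * δ ≤ (σ1 / σr)⁻¹ * ε₀ * σr / 100)
    (hσ : σ = ‖U0 * realDiagonal s0 * U0ᵀ‖ / (1 - ε₀))
    {Z0 : Matrix (Fin ns) (Fin r) ℂ}
    (hZ0 : Z0 = projC (2 * √(μ * r * σ / N)) (U0 * realDiagonal (fun k => √(s0 k)))) :
    σ1 ≤ σ ∧
    distP Z0 (U * realDiagonal (fun k => √(s k))) ≤ 1.6 * (σ1 / σr)⁻¹ * ε₀ * √σr ∧
    ∃ P0 : Matrix (Fin r) (Fin r) ℂ, IsUnit P0 ∧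
      Real.sqrt (frobNorm (Z0 - U * realDiagonal (fun k => √(s k)) * P0) ^ 2
        + frobNorm (Z0 - U * realDiagonal (fun k => √(s k)) * (P0⁻¹)ᵀ) ^ 2)
        = distP Z0 (U * realDiagonal (fun k => √(s k))) ∧
      ∀ Zsi : Matrix (Fin ns) (Fin r) ℂ,
        (Zsi = U * realDiagonal (fun k => √(s k)) * P0
          ∨ Zsi = U * realDiagonal (fun k => √(s k)) * (P0⁻¹)ᵀ) →
        sigmaMin Zsi ≥ (1 - 6.4 * (σ1 / σr)⁻¹ * ε₀) * √σr
          ∧ specNorm Zsi ≤ (1 + 6.4 * (σ1 / σr)⁻¹ * ε₀) * √σ1 := by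
  obtain ⟨k1, hk1⟩ := hs1'
  have hσ1r : σr ≤ σ1 := (hs k1).trans (hs1 k1)
  have hσ1 : 0 < σ1 := hσr.trans_le hσ1r
  have hδ0 : 0 ≤ δ := (norm_nonneg _).trans hδ
  set e := (σ1 / σr)⁻¹ * ε₀ with he
  have hκ : (σ1 / σr)⁻¹ ≤ 1 := inv_le_one_of_one_le₀ ((one_le_div hσr).2 hσ1r)
  have he0 : 0 < e := by positivity
  have heε : e ≤ ε₀ := by nlinarith
  have hr1 : 1 ≤ √(r : ℝ) := Real.one_le_sqrt.2 (by exact_mod_cast hr)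
  have hδe : δ ≤ e * σr / 100 := by
    linarith [mul_le_mul_of_nonneg_right hr1 hδ0]
  have heσ : e * σr ≤ σr / 10 := by
    linarith [mul_le_mul_of_nonneg_right (heε.trans hε1) hσr.le]
  have hδσ : δ ≤ σr / 100 := by linarith
  have hsr : 0 < √σr := Real.sqrt_pos.2 hσr
  have hsq : √σr * √σr = σr := Real.mul_self_sqrt hσr.le
  have hs1r : √σr ≤ √σ1 := Real.sqrt_le_sqrt hσ1r
  have hs0' := sub_le_of_perturbation hU hU0 hσr hs hs0 hδ (by linarith)
  obtain ⟨P, hP, hZP, hPQ, hrows⟩ := exists_alignment hU hU0 hσr hs hs0 hδ hδσ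
  set M0 := U0 * realDiagonal s0 * U0ᵀ with hM0
  set M := U * realDiagonal s * Uᵀ with hM
  set Zs := U * realDiagonal (fun k => √(s k)) with hZs
  set Zt := U0 * realDiagonal (fun k => √(s0 k)) with hZt
  have hMge : σ1 ≤ ‖M‖ := by
    rw [← hk1]; exact (le_abs_self _).trans (le_l2_opNorm_diag hU k1)
  have hUn := l2_opNorm_le_one_of_conjTranspose_mul_self hU
  have hMle : ‖M‖ ≤ σ1 := by
    refine (mul_three_norm_le (z := 1) _ _ _ hUn (l2_opNorm_realDiagonal_le hσ1.le fun k => ?_)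
      (by rwa [l2_opNorm_transpose])).trans_eq (by ring)
    rw [abs_of_pos (hσr.trans_le (hs k))]
    exact hs1 k
  have hm0 : ‖M‖ - δ ≤ ‖M0‖ := by
    have := norm_sub_norm_le M M0
    rw [norm_sub_rev] at this
    linarith
  have hm0' : ‖M0‖ ≤ ‖M‖ + δ := by
    have := norm_sub_norm_le M0 M
    linarith
  have hδε : δ ≤ ε₀ * σ1 / 100 := by
    linarith [mul_le_mul heε hσ1r hσr.le hε0.le]
  have hσ1σ : σ1 ≤ σ := by
    rw [hσ, le_div_iff₀ (by linarith)]
    linarith [mul_pos hε0 hσ1]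
  have hm0σ : ‖M0‖ ≤ σ := by
    rw [hσ, le_div_iff₀ (by linarith)]
    linarith [mul_nonneg hε0.le (norm_nonneg M0)]
  -- Frobenius bounds before clipping
  set b := √(r : ℝ) * (2 * δ / √σr) with hb
  have hbe : b ≤ e * √σr / 50 := by
    rw [hb, ← mul_div_assoc, div_le_iff₀ hsr]
    have : e * (√σr * √σr) = e * σr := by rw [hsq]
    linarith
  have hb0 : 0 ≤ b := by positivity
  have hdb : 2 * δ / √σr ≤ b := le_mul_of_one_le_left (by positivity) hr1
  have hF1 : frobNorm (Zt - Zs * P) ≤ b :=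
    (frobNorm_le_sqrt_mul_l2_opNorm _).trans (by rw [hb]; gcongr)
  have hF2 : frobNorm (Zs * P - Zs * (P⁻¹)ᵀ) ≤ b :=
    (frobNorm_le_sqrt_mul_l2_opNorm _).trans (by rw [hb]; gcongr)
  have hF3 : frobNorm (Zt - Zs * (P⁻¹)ᵀ) ≤ 2 * b := by
    have := frobNorm_add_le (Zt - Zs * P) (Zs * P - Zs * (P⁻¹)ᵀ)
    rw [sub_add_sub_cancel] at this
    linarith
  -- row bounds
  have hrowU : ∀ i, vecNorm (U i) ≤ √(2 * μ * r / N) := fun i => by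
    refine (vecNorm_row_le_norm2inf U i).trans (hrow.trans (Real.sqrt_le_sqrt ?_))
    gcongr
  have hq0 : 0 ≤ μ * r * σ / N := by
    have : 0 ≤ σ := hσ1.le.trans hσ1σ
    have : 0 ≤ μ := hμ₀.le.trans hμ
    positivity
  have hτ : √(2 * μ * r / N) * (1.01 * √σ) ≤ 2 * √(μ * r * σ / N) := by
    have h1 : √(2 * μ * r / N) * √σ = √(2 * (μ * r * σ / N)) := by
      rw [← Real.sqrt_mul' _ (hσ1.le.trans hσ1σ)]
      congr 1
      ring
    have h2 : √(2 : ℝ) ≤ 1.5 := by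
      rw [Real.sqrt_le_left (by norm_num)]; norm_num
    rw [mul_left_comm, h1, Real.sqrt_mul (by norm_num)]
    linarith [mul_le_mul_of_nonneg_right h2 (Real.sqrt_nonneg (μ * r * σ / N)),
      Real.sqrt_nonneg (μ * r * σ / N)]
  have hσσ : √‖M0‖ ≤ √σ := Real.sqrt_le_sqrt hm0σ
  have hsrσ : √σr ≤ √σ := Real.sqrt_le_sqrt (hσ1r.trans hσ1σ)
  have hdσ : √‖M0‖ + 2 * δ / √σr ≤ 1.01 * √σ := by
    linarith [mul_le_mul_of_nonneg_right (heε.trans hε1) hsr.le]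
  have hX1 : ∀ i, vecNorm ((Zs * P) i) ≤ 2 * √(μ * r * σ / N) := fun i => by
    refine (hrows i).1.trans (le_trans ?_ hτ)
    exact mul_le_mul (hrowU i) (by linarith [Real.sqrt_nonneg σ]) (Real.sqrt_nonneg _)
      (Real.sqrt_nonneg _)
  have hX2 : ∀ i, vecNorm ((Zs * (P⁻¹)ᵀ) i) ≤ 2 * √(μ * r * σ / N) := fun i => by
    refine (hrows i).2.trans (le_trans ?_ hτ)
    exact mul_le_mul (hrowU i) hdσ
      (add_nonneg (Real.sqrt_nonneg _) (div_nonneg (by linarith) hsr.le)) (Real.sqrt_nonneg _)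
  have hG1 : frobNorm (Z0 - Zs * P) ≤ b := by
    rw [hZ0]; exact (frobNorm_projC_sub_le hX1).trans hF1
  have hG2 : frobNorm (Z0 - Zs * (P⁻¹)ᵀ) ≤ 2 * b := by
    rw [hZ0]; exact (frobNorm_projC_sub_le hX2).trans hF3
  have hdist : distP Z0 Zs ≤ 3 * b := by
    refine (distP_le Z0 Zs hP).trans ?_
    rw [Real.sqrt_le_left (by positivity)]
    linarith [pow_le_pow_left₀ (frobNorm_nonneg _) hG1 2, pow_le_pow_left₀ (frobNorm_nonneg _) hG2 2,
      sq_nonneg b]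
  -- a left inverse of the reference factor
  have hL : (realDiagonal (fun k => (√(s k))⁻¹) * Uᴴ) * Zs = 1 := by
    rw [hZs, Matrix.mul_assoc, ← Matrix.mul_assoc Uᴴ, hU, Matrix.one_mul, realDiagonal_mul]
    exact realDiagonal_eq_one fun k =>
      inv_mul_cancel₀ (Real.sqrt_pos.2 (hσr.trans_le (hs k))).ne'
  obtain ⟨P0, hP0, hP0d⟩ := exists_distP_minimizer Z0 Zs _ hL
  refine ⟨hσ1σ, ?_, P0, hP0, hP0d, fun Zsi hZsi => ?_⟩
  · have : 1.6 * (σ1 / σr)⁻¹ * ε₀ * √σr = 1.6 * (e * √σr) := by rw [he]; ring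
    rw [this]
    linarith [mul_pos he0 hsr]
  have hFi : frobNorm (Z0 - Zsi) ≤ 3 * b := by
    refine le_trans ?_ (hP0d.trans_le hdist)
    rcases hZsi with rfl | rfl
    · exact Real.le_sqrt_of_sq_le (le_add_of_nonneg_right (sq_nonneg _))
    · exact Real.le_sqrt_of_sq_le (le_add_of_nonneg_left (sq_nonneg _))
  have hdiff : ‖Zt - Zsi‖ ≤ e * √σr / 10 := by
    have h1 : Zt - Zsi = (Zt - Zs * P) - (Z0 - Zs * P) + (Z0 - Zsi) := by abel
    have h2 := norm_add_le ((Zt - Zs * P) - (Z0 - Zs * P)) (Z0 - Zsi)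
    have h3 := norm_sub_le (Zt - Zs * P) (Z0 - Zs * P)
    have h4 := l2_opNorm_le_frobNorm (Z0 - Zs * P)
    have h5 := l2_opNorm_le_frobNorm (Z0 - Zsi)
    rw [h1]
    linarith
  have e1 : (1 - 6.4 * (σ1 / σr)⁻¹ * ε₀) = 1 - 6.4 * e := by rw [he]; ring
  have e2 : (1 + 6.4 * (σ1 / σr)⁻¹ * ε₀) = 1 + 6.4 * e := by rw [he]; ring
  rw [e1, e2]
  constructor
  · refine le_sigmaMin (by omega) fun v => ?_
    have h1 : (1 - e / 100) * √σr * vecNorm v ≤ vecNorm (Zt *ᵥ v) := by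
      rw [hZt, ← Matrix.mulVec_mulVec, vecNorm_mulVec_of_conjTranspose_mul_self hU0]
      refine le_vecNorm_realDiagonal_mulVec (mul_nonneg (by linarith) hsr.le) (fun k => ?_) v
      apply Real.le_sqrt_of_sq_le
      refine le_trans ?_ (hs0' k)
      rw [mul_pow, sq (√σr), hsq]
      linarith [mul_le_mul_of_nonneg_left heσ he0.le, mul_pos he0 hσr]
    have h2 := vecNorm_sub_le (Zt *ᵥ v) (Zsi *ᵥ v)
    rw [← Matrix.sub_mulVec] at h2
    have h3 := (vecNorm_mulVec_le (Zt - Zsi) v).trans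
      (mul_le_mul_of_nonneg_right hdiff (vecNorm_nonneg v))
    linarith [mul_nonneg (mul_pos he0 hsr).le (vecNorm_nonneg v)]
  · rw [specNorm_eq_norm]
    have h1 : ‖Zt‖ ≤ √‖M0‖ := by
      refine l2_opNorm_le_diag hU0 (Real.sqrt_nonneg _) fun k => ?_
      rw [abs_of_nonneg (Real.sqrt_nonneg _)]
      exact Real.sqrt_le_sqrt ((le_abs_self _).trans (le_l2_opNorm_diag hU0 k))
    have h2 : √‖M0‖ ≤ (1 + e) * √σ1 := by
      rw [Real.sqrt_le_left (by positivity), mul_pow, Real.sq_sqrt hσ1.le]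
      linarith [mul_le_mul_of_nonneg_left hσ1r he0.le, mul_pos he0 hσ1,
        mul_pos (mul_pos he0 he0) hσ1]
    have h3 : ‖Zsi‖ ≤ ‖Zt‖ + ‖Zt - Zsi‖ := by
      have := norm_sub_norm_le Zsi Zt
      rw [norm_sub_rev] at this
      linarith
    linarith [mul_le_mul_of_nonneg_left hs1r he0.le, mul_pos he0 (hsr.trans_le hs1r)]

end Deterministic

section Hankel

open scoped Matrix.Norms.L2Operator

/-- Orthogonality of the powers of a primitive root of unity. -/
lemma sum_pow_mul_inv_pow {n : ℕ} {ζ : ℂ} (hζ : IsPrimitiveRoot ζ n) {a b : ℕ} (ha : a < n)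
    (hb : b < n) :
    ∑ k : Fin n, ζ ^ ((k : ℕ) * a) * ζ⁻¹ ^ ((k : ℕ) * b) = if a = b then (n : ℂ) else 0 := by
  have hζ0 : ζ ≠ 0 := hζ.ne_zero (by omega)
  have h1 : ∀ k : Fin n, ζ ^ ((k : ℕ) * a) * ζ⁻¹ ^ ((k : ℕ) * b)
      = (ζ ^ a * ζ⁻¹ ^ b) ^ (k : ℕ) := fun k => by
    rw [mul_pow, ← pow_mul, ← pow_mul, mul_comm a, mul_comm b]
  simp_rw [h1]
  rw [Fin.sum_univ_eq_sum_range (fun k => (ζ ^ a * ζ⁻¹ ^ b) ^ k) n]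
  split_ifs with hab
  · subst hab
    rw [← mul_pow, mul_inv_cancel₀ hζ0]
    simp
  · have hx : ζ ^ a * ζ⁻¹ ^ b ≠ 1 := fun h => by
      rw [inv_pow, ← div_eq_mul_inv, div_eq_one_iff_eq (pow_ne_zero _ hζ0)] at h
      exact hab (hζ.pow_inj ha hb h)
    rw [geom_sum_eq hx, mul_pow, ← pow_mul, ← pow_mul, mul_comm a, mul_comm b, pow_mul, pow_mul,
      inv_pow, hζ.pow_eq_one]
    simp

/-- The spectral norm of a Hankel matrix is bounded by the largest Fourier coefficient of its
generating vector. -/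
lemma l2_opNorm_hankel_le {ns : ℕ} {ζ : ℂ} (hζ : IsPrimitiveRoot ζ (2 * ns - 1))
    {H : Matrix (Fin ns) (Fin ns) ℂ} (h : ℕ → ℂ) (hHh : ∀ i j, H i j = h ((i : ℕ) + (j : ℕ)))
    {c : ℝ} (hc : 0 ≤ c)
    (hp : ∀ k : Fin (2 * ns - 1),
      ‖∑ a : Fin (2 * ns - 1), h a * ζ ^ ((k : ℕ) * (a : ℕ))‖ ≤ c) :
    ‖H‖ ≤ c := by
  rcases Nat.eq_zero_or_pos ns with rfl | hns
  · rw [Subsingleton.elim H 0, norm_zero]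
    exact hc
  set n := 2 * ns - 1 with hn
  have hn0 : 0 < n := by omega
  have hnC : (n : ℂ) ≠ 0 := by exact_mod_cast hn0.ne'
  have hζ1 : ‖ζ‖ = 1 := hζ.norm'_eq_one hn0.ne'
  have hsq : ((√(n : ℝ) : ℝ) : ℂ)⁻¹ * ((√(n : ℝ) : ℝ) : ℂ)⁻¹ = (n : ℂ)⁻¹ := by
    rw [← mul_inv, ← Complex.ofReal_mul, Real.mul_self_sqrt (Nat.cast_nonneg _)]
    simp
  let F : Matrix (Fin n) (Fin ns) ℂ :=
    Matrix.of fun k i => ζ⁻¹ ^ ((k : ℕ) * (i : ℕ)) * ((√(n : ℝ) : ℝ) : ℂ)⁻¹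
  have hF : Fᴴ * F = 1 := by
    ext i j
    have hi := i.isLt
    have hj := j.isLt
    have h1 : ∀ k : Fin n, star (F k i) * F k j
        = ζ ^ ((k : ℕ) * (i : ℕ)) * ζ⁻¹ ^ ((k : ℕ) * (j : ℕ)) * (n : ℂ)⁻¹ := fun k => by
      have : star (F k i) = ζ ^ ((k : ℕ) * (i : ℕ)) * ((√(n : ℝ) : ℝ) : ℂ)⁻¹ := by
        simp only [F, Matrix.of_apply, Complex.inv_eq_conj hζ1, star_mul', star_pow,
          star_inv₀, Complex.star_def, Complex.conj_conj, Complex.conj_ofReal]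
      rw [this, ← hsq]
      simp only [F, Matrix.of_apply]
      ring
    simp only [Matrix.mul_apply, Matrix.conjTranspose_apply]
    simp_rw [h1]
    rw [← Finset.sum_mul, sum_pow_mul_inv_pow hζ (by omega) (by omega), Matrix.one_apply]
    simp only [Fin.val_inj]
    split_ifs
    · exact mul_inv_cancel₀ hnC
    · exact zero_mul _
  have hH : H = Fᵀ * Matrix.diagonal
        (fun k : Fin n => ∑ a : Fin n, h a * ζ ^ ((k : ℕ) * (a : ℕ))) * F := by
    ext i j
    have hi := i.isLt
    have hj := j.isLt
    have h1 : ∀ k : Fin n,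
        F k i * (∑ a : Fin n, h a * ζ ^ ((k : ℕ) * (a : ℕ))) * F k j
        = ∑ a : Fin n, h a * (n : ℂ)⁻¹ *
          (ζ ^ ((k : ℕ) * (a : ℕ)) * ζ⁻¹ ^ ((k : ℕ) * ((i : ℕ) + (j : ℕ)))) := fun k => by
      rw [Finset.mul_sum, Finset.sum_mul]
      refine Finset.sum_congr rfl fun a _ => ?_
      rw [← hsq, mul_add, pow_add]
      simp only [F, Matrix.of_apply]
      ring
    rw [hHh, Matrix.mul_apply]
    simp only [Matrix.mul_diagonal, Matrix.transpose_apply]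
    simp_rw [h1]
    rw [Finset.sum_comm]
    simp_rw [← Finset.mul_sum]
    have h2 : ∀ a : Fin n, ∑ k : Fin n,
        ζ ^ ((k : ℕ) * (a : ℕ)) * ζ⁻¹ ^ ((k : ℕ) * ((i : ℕ) + (j : ℕ)))
        = if (a : ℕ) = (i : ℕ) + (j : ℕ) then (n : ℂ) else 0 := fun a =>
      sum_pow_mul_inv_pow hζ a.isLt (by omega)
    simp_rw [h2]
    rw [Finset.sum_eq_single (⟨(i : ℕ) + (j : ℕ), by omega⟩ : Fin n)]
    · simp [hnC]
    · intro a _ ha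
      rw [if_neg fun h => ha (Fin.ext h), mul_zero]
    · simp
  have hF1 := l2_opNorm_le_one_of_conjTranspose_mul_self hF
  rw [hH]
  have := mul_three_norm_le Fᵀ (Matrix.diagonal
    (fun k : Fin n => ∑ a : Fin n, h a * ζ ^ ((k : ℕ) * (a : ℕ)))) F
    ((l2_opNorm_transpose F).trans_le hF1) (l2_opNorm_diagonal_le hc hp) hF1
  simpa using this

end Hankel

section Concentration

variable {ι : Type*} [Fintype ι]

/-- Exponential Markov inequality for uniform sampling with replacement, for centered `f`. -/
lemma card_filter_sum_ge_le (f : ι → ℝ) (m : ℕ) {B V l s : ℝ} (hι : 0 < Fintype.card ι)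
    (hf0 : ∑ a, f a = 0) (hf : ∀ a, |f a| ≤ B) (hV : ∑ a, f a ^ 2 ≤ V) (hl : 0 ≤ l)
    (hlB : l * B ≤ 1) :
    ((Finset.univ.filter fun ω : Fin m → ι => s ≤ ∑ j, f (ω j)).card : ℝ)
      ≤ (Fintype.card ι : ℝ) ^ m * Real.exp (m * (l ^ 2 * V / Fintype.card ι) - l * s) := by
  have hn : (0 : ℝ) < Fintype.card ι := by exact_mod_cast hι
  have h1 : ∑ a, Real.exp (l * f a)
      ≤ Fintype.card ι * Real.exp (l ^ 2 * V / Fintype.card ι) := by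
    have h2 : ∀ a, Real.exp (l * f a) ≤ 1 + l * f a + l ^ 2 * f a ^ 2 := fun a => by
      have habs : |l * f a| ≤ 1 := by
        rw [abs_mul, abs_of_nonneg hl]
        exact (mul_le_mul_of_nonneg_left (hf a) hl).trans hlB
      have := (abs_le.1 (Real.abs_exp_sub_one_sub_id_le habs)).2
      linarith [mul_pow l (f a) 2]
    calc ∑ a, Real.exp (l * f a) ≤ ∑ a, (1 + l * f a + l ^ 2 * f a ^ 2) :=
          Finset.sum_le_sum fun a _ => h2 a
      _ = Fintype.card ι + l ^ 2 * ∑ a, f a ^ 2 := by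
          rw [Finset.sum_add_distrib, Finset.sum_add_distrib, ← Finset.mul_sum, ← Finset.mul_sum,
            hf0]
          simp
      _ ≤ Fintype.card ι * (l ^ 2 * V / Fintype.card ι + 1) := by
          rw [mul_add, mul_div_cancel₀ _ hn.ne', mul_one, add_comm]
          gcongr
      _ ≤ _ := by gcongr; exact Real.add_one_le_exp _
  have h3 : ((Finset.univ.filter fun ω : Fin m → ι => s ≤ ∑ j, f (ω j)).card : ℝ)
      * Real.exp (l * s) ≤ (∑ a, Real.exp (l * f a)) ^ m := by
    rw [Fintype.sum_pow, ← nsmul_eq_mul, ← Finset.sum_const]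
    refine (Finset.sum_le_sum fun ω hω => ?_).trans
      (Finset.sum_le_univ_sum_of_nonneg fun ω => Finset.prod_nonneg fun j _ => (Real.exp_pos _).le)
    rw [← Real.exp_sum, ← Finset.mul_sum]
    exact Real.exp_le_exp.2 (mul_le_mul_of_nonneg_left (Finset.mem_filter.1 hω).2 hl)
  have h4 := h3.trans (pow_le_pow_left₀ (Finset.sum_nonneg fun a _ => (Real.exp_pos _).le) h1 m)
  rw [mul_pow, ← Real.exp_nat_mul] at h4
  rw [Real.exp_sub, ← mul_div_assoc, le_div_iff₀ (Real.exp_pos _)]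
  exact h4

/-- One-sided Bernstein-type bound for the sampled estimator of a finite sum. -/
lemma card_filter_estimator_ge_le (f : ι → ℝ) {m : ℕ} (hm : 0 < m) {B V t : ℝ}
    (hι : 0 < Fintype.card ι) (hf : ∀ a, |f a| ≤ B) (hV : ∑ a, f a ^ 2 ≤ V) (hV0 : 0 < V)
    (ht : 0 ≤ t) (htB : t * B ≤ V) :
    ((Finset.univ.filter fun ω : Fin m → ι =>
        t ≤ (Fintype.card ι / m : ℝ) * ∑ j, f (ω j) - ∑ a, f a).card : ℝ)
      ≤ (Fintype.card ι : ℝ) ^ m * Real.exp (-(m / Fintype.card ι * t ^ 2 / (4 * V))) := by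
  have hn : (0 : ℝ) < Fintype.card ι := by exact_mod_cast hι
  have hm' : (0 : ℝ) < m := by exact_mod_cast hm
  set n : ℝ := (Fintype.card ι : ℝ) with hndef
  set c : ℝ := (∑ a, f a) / n with hc
  have hnc : n * c = ∑ a, f a := mul_div_cancel₀ _ hn.ne'
  have hcB : |c| ≤ B := by
    rw [hc, abs_div, abs_of_pos hn, div_le_iff₀ hn]
    refine (Finset.abs_sum_le_sum_abs _ _).trans ((Finset.sum_le_sum fun a _ => hf a).trans ?_)
    rw [Finset.sum_const, Finset.card_univ, nsmul_eq_mul, mul_comm]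
  have hsum : ∑ a, (f a - c) = 0 := by
    rw [Finset.sum_sub_distrib, ← hnc, Finset.sum_const, Finset.card_univ, nsmul_eq_mul, sub_self]
  have hsq : ∑ a, (f a - c) ^ 2 ≤ V := by
    have h : ∑ a, (f a - c) ^ 2 = ∑ a, f a ^ 2 - 2 * c * ∑ a, f a + n * c ^ 2 := by
      rw [Finset.mul_sum, ← Finset.sum_sub_distrib, hndef, ← nsmul_eq_mul, ← Finset.card_univ,
        ← Finset.sum_const, ← Finset.sum_add_distrib]
      exact Finset.sum_congr rfl fun a _ => by ring
    rw [h, ← hnc]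
    linarith [mul_nonneg hn.le (sq_nonneg c), show 2 * c * (n * c) = 2 * (n * c ^ 2) by ring]
  have key := card_filter_sum_ge_le (fun a => f a - c) m (B := 2 * B) (V := V) (l := t / (2 * V))
    (s := t * m / n) hι hsum
    (fun a => (abs_sub _ _).trans (by linarith [hf a])) hsq (by positivity)
    (by
      rw [div_mul_eq_mul_div, div_le_one (by positivity)]
      linarith)
  refine (Nat.cast_le.2 (Finset.card_le_card fun ω hω => ?_)).trans (key.trans_eq ?_)
  · simp only [Finset.mem_filter, Finset.mem_univ, true_and] at hω ⊢
    rw [Finset.sum_sub_distrib, Finset.sum_const, Finset.card_univ, Fintype.card_fin, nsmul_eq_mul]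
    have h5 := mul_le_mul_of_nonneg_right hω (div_pos hm' hn).le
    have h6 : (n / m * ∑ j, f (ω j) - ∑ a, f a) * (m / n) = ∑ j, f (ω j) - m * c := by
      rw [← hnc]
      field_simp
    rw [h6, ← mul_div_assoc] at h5
    exact h5
  · congr 2
    field_simp
    ring

/-- Bernstein-type bound for the sampled estimator of a finite sum of complex numbers. -/
lemma card_filter_norm_estimator_gt_le (g : ι → ℂ) {m : ℕ} (hm : 0 < m) {B V t : ℝ}
    (hι : 0 < Fintype.card ι) (hg : ∀ a, ‖g a‖ ≤ B) (hV : ∑ a, ‖g a‖ ^ 2 ≤ V) (hV0 : 0 < V)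
    (ht : 0 ≤ t) (htB : t * B ≤ V) :
    ((Finset.univ.filter fun ω : Fin m → ι =>
        2 * t < ‖((Fintype.card ι / m : ℝ) : ℂ) * ∑ j, g (ω j) - ∑ a, g a‖).card : ℝ)
      ≤ 4 * ((Fintype.card ι : ℝ) ^ m *
        Real.exp (-(m / Fintype.card ι * t ^ 2 / (4 * V)))) := by
  have key : ∀ L : ℂ →+ ℝ, (∀ z, |L z| ≤ ‖z‖) →
      ((Finset.univ.filter fun ω : Fin m → ι =>
        t ≤ (Fintype.card ι / m : ℝ) * ∑ j, L (g (ω j)) - ∑ a, L (g a)).card : ℝ)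
      ≤ (Fintype.card ι : ℝ) ^ m * Real.exp (-(m / Fintype.card ι * t ^ 2 / (4 * V))) :=
    fun L hL => card_filter_estimator_ge_le (fun a => L (g a)) hm hι
      (fun a => (hL _).trans (hg a))
      ((Finset.sum_le_sum fun a _ => by
        rw [← sq_abs]
        exact pow_le_pow_left₀ (abs_nonneg _) (hL _) 2).trans hV) hV0 ht htB
  have h1 := key Complex.reAddGroupHom Complex.abs_re_le_norm
  have h2 := key Complex.imAddGroupHom Complex.abs_im_le_norm
  have h3 := key (-Complex.reAddGroupHom) fun z => by simpa using Complex.abs_re_le_norm z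
  have h4 := key (-Complex.imAddGroupHom) fun z => by simpa using Complex.abs_im_le_norm z
  simp only [AddMonoidHom.neg_apply, Complex.coe_reAddGroupHom, Complex.coe_imAddGroupHom,
    Finset.sum_neg_distrib] at h1 h2 h3 h4
  have hsub : (Finset.univ.filter fun ω : Fin m → ι =>
        2 * t < ‖((Fintype.card ι / m : ℝ) : ℂ) * ∑ j, g (ω j) - ∑ a, g a‖)
      ⊆ ((Finset.univ.filter fun ω : Fin m → ι =>
          t ≤ (Fintype.card ι / m : ℝ) * ∑ j, (g (ω j)).re - ∑ a, (g a).re)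
        ∪ (Finset.univ.filter fun ω : Fin m → ι =>
          t ≤ (Fintype.card ι / m : ℝ) * ∑ j, (g (ω j)).im - ∑ a, (g a).im))
      ∪ ((Finset.univ.filter fun ω : Fin m → ι =>
          t ≤ (Fintype.card ι / m : ℝ) * -∑ j, (g (ω j)).re - -∑ a, (g a).re)
        ∪ (Finset.univ.filter fun ω : Fin m → ι =>
          t ≤ (Fintype.card ι / m : ℝ) * -∑ j, (g (ω j)).im - -∑ a, (g a).im)) := by
    intro ω hω
    simp only [Finset.mem_filter, Finset.mem_univ, true_and, Finset.mem_union] at hω ⊢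
    by_contra! hcon
    obtain ⟨⟨c1, c2⟩, c3, c4⟩ := hcon
    have h5 := hω.trans_le (Complex.norm_le_abs_re_add_abs_im _)
    rw [Complex.sub_re, Complex.sub_im, Complex.re_ofReal_mul, Complex.im_ofReal_mul,
      Complex.re_sum, Complex.im_sum, Complex.re_sum, Complex.im_sum] at h5
    have h6 := abs_lt.2 ⟨by linarith, c1⟩
    have h7 := abs_lt.2 ⟨by linarith, c2⟩
    linarith
  have hcard := (Finset.card_le_card hsub).trans ((Finset.card_union_le _ _).trans
    (add_le_add (Finset.card_union_le _ _) (Finset.card_union_le _ _)))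
  have hcard' := Nat.cast_le (α := ℝ).2 hcard
  rw [Nat.cast_add, Nat.cast_add, Nat.cast_add] at hcard'
  set E := (Fintype.card ι : ℝ) ^ m * Real.exp (-(m / Fintype.card ι * t ^ 2 / (4 * V)))
  calc _ ≤ _ := hcard'
    _ ≤ (E + E) + (E + E) :=
      add_le_add (add_le_add h1 h2) (add_le_add (by convert h3) (by convert h4))
    _ = 4 * E := by ring

end Concentration

section Sampling

open scoped Matrix.Norms.L2Operator

lemma norm_mul_realDiagonal_mul_transpose_apply_le {ns r : ℕ} {U : Matrix (Fin ns) (Fin r) ℂ}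
    {s : Fin r → ℝ} {c ρ : ℝ} (hc : 0 ≤ c) (hs : ∀ k, |s k| ≤ c)
    (hρ : ∀ i, vecNorm (U i) ^ 2 ≤ ρ) (i j : Fin ns) :
    ‖(U * realDiagonal s * Uᵀ) i j‖ ≤ c * ρ := by
  have h1 : (U * realDiagonal s * Uᵀ) i j = ∑ k, U i k * (s k : ℂ) * U j k := by
    rw [Matrix.mul_apply]
    simp [realDiagonal, Matrix.mul_diagonal]
  rw [h1]
  have h2 : ∀ k, ‖U i k * (s k : ℂ) * U j k‖ ≤ c * ((‖U i k‖ ^ 2 + ‖U j k‖ ^ 2) / 2) := fun k => by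
    rw [norm_mul, norm_mul, Complex.norm_real, Real.norm_eq_abs, mul_right_comm, mul_comm]
    exact mul_le_mul (hs k) (by linarith [two_mul_le_add_sq ‖U i k‖ ‖U j k‖]) (by positivity) hc
  refine (norm_sum_le _ _).trans ((Finset.sum_le_sum fun k _ => h2 k).trans ?_)
  rw [← Finset.mul_sum, ← Finset.sum_div, Finset.sum_add_distrib, ← vecNorm_sq, ← vecNorm_sq]
  exact mul_le_mul_of_nonneg_left (by linarith [hρ i, hρ j]) hc

lemma sum_sq_row_mul_realDiagonal_mul_transpose_le {ns r : ℕ} {U : Matrix (Fin ns) (Fin r) ℂ}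
    (hU : Uᴴ * U = 1) {s : Fin r → ℝ} {c ρ : ℝ} (hc : 0 ≤ c) (hs : ∀ k, |s k| ≤ c)
    (hρ : ∀ i, vecNorm (U i) ^ 2 ≤ ρ) (i : Fin ns) :
    ∑ j, ‖(U * realDiagonal s * Uᵀ) i j‖ ^ 2 ≤ c ^ 2 * ρ := by
  have h1 : ‖realDiagonal s * Uᵀ‖ ≤ c := by
    refine (Matrix.l2_opNorm_mul _ _).trans ?_
    have := mul_le_mul (l2_opNorm_realDiagonal_le hc hs)
      ((l2_opNorm_transpose U).trans_le (l2_opNorm_le_one_of_conjTranspose_mul_self hU))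
      (norm_nonneg _) hc
    simpa using this
  have h2 := (vecNorm_row_mul_le U (realDiagonal s * Uᵀ) i).trans
    (mul_le_mul_of_nonneg_left h1 (vecNorm_nonneg _))
  rw [← Matrix.mul_assoc] at h2
  rw [← vecNorm_sq]
  refine (pow_le_pow_left₀ (vecNorm_nonneg _) h2 2).trans ?_
  rw [mul_pow, mul_comm]
  exact mul_le_mul_of_nonneg_left (hρ i) (sq_nonneg c)

lemma sum_range_two_mul_sub_one_le {ns : ℕ} (hns : 1 ≤ ns) {f : ℕ → ℝ} (hf : ∀ a, 0 ≤ f a) :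
    ∑ a ∈ Finset.range (2 * ns - 1), f a
      ≤ ∑ j ∈ Finset.range ns, f j + ∑ j ∈ Finset.range ns, f (ns - 1 + j) := by
  obtain ⟨k, rfl⟩ : ∃ k, ns = k + 1 := ⟨ns - 1, by omega⟩
  rw [show 2 * (k + 1) - 1 = (k + 1) + k by omega, Finset.sum_range_add,
    Finset.sum_range_succ' (fun j => f (k + 1 - 1 + j))]
  have : ∀ x, f (k + 1 + x) = f (k + 1 - 1 + (x + 1)) := fun x => congrArg f (by omega)
  simp_rw [this]
  linarith [hf (k + 1 - 1 + 0)]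

/-- The spectral error of the sampled Hankel estimator is controlled by the errors of its
Fourier coefficients. -/
lemma l2_opNorm_estimator_sub_le {ns m : ℕ} {ζ : ℂ} (hζ : IsPrimitiveRoot ζ (2 * ns - 1))
    (y : Fin (2 * ns - 1) → ℂ) (ω : Fin m → Fin (2 * ns - 1)) {t : ℝ} (ht : 0 ≤ t)
    (h : ∀ k : Fin (2 * ns - 1),
      ‖((((2 * ns - 1 : ℕ) : ℝ) / m : ℝ) : ℂ)
          * ∑ j, y (ω j) / ((√(hw ns (ω j)) : ℝ) : ℂ) * ζ ^ ((k : ℕ) * (ω j : ℕ))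
        - ∑ a, y a / ((√(hw ns a) : ℝ) : ℂ) * ζ ^ ((k : ℕ) * (a : ℕ))‖ ≤ t) :
    ‖(((2 * ns - 1 : ℕ) / (m : ℝ)) • ∑ j : Fin m, y (ω j) • Gop ns (Pi.single (ω j) 1))
      - Gop ns y‖ ≤ t := by
  let g : ℕ → ℂ := fun a => if ha : a < 2 * ns - 1 then y ⟨a, ha⟩ / ((√(hw ns a) : ℝ) : ℂ) else 0
  have hg : ∀ a : Fin (2 * ns - 1), g a = y a / ((√(hw ns a) : ℝ) : ℂ) := fun a => by
    simp [g]
  refine l2_opNorm_hankel_le hζ (fun a => ((((2 * ns - 1 : ℕ) : ℝ) / m : ℝ) : ℂ)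
    * ∑ j, (if (ω j : ℕ) = a then g a else 0) - g a) (fun i j => ?_) ht fun k => ?_
  · have hi := i.isLt
    have hj := j.isLt
    have h1 := hg ⟨(i : ℕ) + (j : ℕ), by omega⟩
    have h2 : ∀ l, (y (ω l) • Gop ns (Pi.single (ω l) 1)) i j
        = if (ω l : ℕ) = (i : ℕ) + (j : ℕ) then g ((i : ℕ) + (j : ℕ)) else 0 := fun l => by
      rw [Matrix.smul_apply, Gop, Pi.single_apply, smul_eq_mul]
      by_cases hl : (ω l : ℕ) = (i : ℕ) + (j : ℕ)
      · have hl' : ω l = ⟨(i : ℕ) + (j : ℕ), by omega⟩ := Fin.ext hl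
        rw [if_pos hl, if_pos hl'.symm, h1, hl', mul_one_div]
      · rw [if_neg hl, if_neg fun h => hl (congrArg Fin.val h.symm)]
        simp
    rw [Matrix.sub_apply, Matrix.smul_apply, Matrix.sum_apply, Complex.real_smul]
    simp_rw [h2]
    rw [Gop, h1]
  · convert h k using 2
    simp_rw [sub_mul]
    rw [Finset.sum_sub_distrib]
    congr 1
    · simp_rw [mul_assoc, ← Finset.mul_sum]
      congr 1
      simp_rw [Finset.sum_mul]
      rw [Finset.sum_comm]
      refine Finset.sum_congr rfl fun j _ => ?_
      rw [Finset.sum_eq_single (ω j)]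
      · rw [if_pos rfl, hg]
      · intro a _ ha
        rw [if_neg fun h => ha (Fin.ext h.symm), zero_mul]
      · simp
    · simp_rw [hg]

/-- The sampled Hankel estimator concentrates around its mean in spectral norm. -/
lemma le_card_filter_l2_opNorm_estimator_sub_le {ns m : ℕ} (hns : 2 ≤ ns) (hm : 0 < m)
    (y : Fin (2 * ns - 1) → ℂ) {B V t : ℝ}
    (hB : ∀ i j, ‖Gop ns y i j‖ ≤ B) (hV : ∀ i, ∑ j, ‖Gop ns y i j‖ ^ 2 ≤ V / 2) (hV0 : 0 < V)
    (ht : 0 ≤ t) (htB : t * B ≤ V)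
    (hexp : 5 * Real.log ((2 * ns - 1 : ℕ) : ℝ)
      ≤ m / ((2 * ns - 1 : ℕ) : ℝ) * t ^ 2 / (4 * V)) :
    (1 - (((2 * ns - 1 : ℕ) : ℝ) ^ 2)⁻¹) * Fintype.card (Fin m → Fin (2 * ns - 1))
      ≤ ((Finset.univ.filter fun ω : Fin m → Fin (2 * ns - 1) =>
        ‖(((2 * ns - 1 : ℕ) / (m : ℝ)) • ∑ j : Fin m, y (ω j) • Gop ns (Pi.single (ω j) 1))
          - Gop ns y‖ ≤ 2 * t).card : ℝ) := by
  set N : ℝ := ((2 * ns - 1 : ℕ) : ℝ) with hN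
  have hnR : (3 : ℝ) ≤ N := by
    rw [hN]
    exact_mod_cast (by omega : 3 ≤ 2 * ns - 1)
  obtain ⟨ζ, hζ⟩ : ∃ ζ : ℂ, IsPrimitiveRoot ζ (2 * ns - 1) :=
    ⟨_, Complex.isPrimitiveRoot_exp _ (by omega)⟩
  have hζ1 : ‖ζ‖ = 1 := hζ.norm'_eq_one (by omega)
  let g : ℕ → ℂ := fun a => if ha : a < 2 * ns - 1 then y ⟨a, ha⟩ / ((√(hw ns a) : ℝ) : ℂ) else 0
  have hg : ∀ a : Fin (2 * ns - 1), g a = y a / ((√(hw ns a) : ℝ) : ℂ) := fun a => by simp [g]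
  have hGg : ∀ i j : Fin ns, Gop ns y i j = g ((i : ℕ) + (j : ℕ)) := fun i j =>
    (hg ⟨(i : ℕ) + (j : ℕ), by have := i.isLt; have := j.isLt; omega⟩).symm
  have hgB : ∀ a : Fin (2 * ns - 1), ‖g a‖ ≤ B := fun a => by
    have ha := a.isLt
    by_cases hlt : (a : ℕ) < ns
    · simpa [hGg] using hB ⟨0, by omega⟩ ⟨a, hlt⟩
    · have := hB ⟨ns - 1, by omega⟩ ⟨(a : ℕ) - (ns - 1), by omega⟩
      rw [hGg] at this
      simpa only [show ns - 1 + ((a : ℕ) - (ns - 1)) = a by omega] using this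
  have hgV : ∑ a : Fin (2 * ns - 1), ‖g a‖ ^ 2 ≤ V := by
    rw [Fin.sum_univ_eq_sum_range (fun a => ‖g a‖ ^ 2) (2 * ns - 1)]
    refine (sum_range_two_mul_sub_one_le (by omega) fun a => by positivity).trans ?_
    have h1 := hV ⟨0, by omega⟩
    have h2 := hV ⟨ns - 1, by omega⟩
    simp_rw [hGg] at h1 h2
    simp only [zero_add] at h1
    rw [Fin.sum_univ_eq_sum_range (fun a => ‖g a‖ ^ 2) ns] at h1
    rw [Fin.sum_univ_eq_sum_range (fun a => ‖g (ns - 1 + a)‖ ^ 2) ns] at h2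
    linarith
  let G : Fin (2 * ns - 1) → Fin (2 * ns - 1) → ℂ := fun k a =>
    y a / ((√(hw ns a) : ℝ) : ℂ) * ζ ^ ((k : ℕ) * (a : ℕ))
  have hGn : ∀ k a, ‖G k a‖ = ‖g a‖ := fun k a => by
    simp only [G]
    rw [norm_mul, norm_pow, hζ1, one_pow, mul_one, hg]
  let bad : Fin (2 * ns - 1) → Finset (Fin m → Fin (2 * ns - 1)) := fun k => Finset.univ.filter fun ω =>
    2 * t < ‖((N / m : ℝ) : ℂ) * ∑ j, G k (ω j) - ∑ a, G k a‖
  have hexp' : Real.exp (-(m / N * t ^ 2 / (4 * V))) ≤ (N ^ 5)⁻¹ := by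
    rw [Real.exp_neg]
    refine inv_anti₀ (by positivity) ?_
    calc N ^ 5 = Real.exp (Real.log N) ^ 5 := by rw [Real.exp_log (by linarith)]
      _ = Real.exp (5 * Real.log N) := by rw [← Real.exp_nat_mul]; norm_num
      _ ≤ _ := Real.exp_le_exp.2 hexp
  have hbad : ∀ k, ((bad k).card : ℝ) ≤ 4 * (N ^ m * (N ^ 5)⁻¹) := fun k => by
    have h1 := card_filter_norm_estimator_gt_le (G k) hm (B := B) (V := V) (t := t)
      (by rw [Fintype.card_fin]; omega) (fun a => (hGn k a).trans_le (hgB a))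
      (by simpa only [hGn] using hgV) hV0 ht htB
    simp only [Fintype.card_fin] at h1
    refine (Eq.le ?_).trans (h1.trans ?_)
    · congr!
    · gcongr
  have hunion : ((Finset.univ.biUnion bad).card : ℝ) ≤ (N ^ 2)⁻¹ * N ^ m := by
    calc ((Finset.univ.biUnion bad).card : ℝ) ≤ ∑ k, ((bad k).card : ℝ) := by
          exact_mod_cast Finset.card_biUnion_le
      _ ≤ ∑ k : Fin (2 * ns - 1), 4 * (N ^ m * (N ^ 5)⁻¹) := Finset.sum_le_sum fun k _ => hbad k
      _ = (4 * (N ^ 2)⁻¹) * ((N ^ 2)⁻¹ * N ^ m) := by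
          rw [Finset.sum_const, Finset.card_univ, Fintype.card_fin, nsmul_eq_mul, ← hN]
          field_simp
      _ ≤ 1 * ((N ^ 2)⁻¹ * N ^ m) := by
          refine mul_le_mul_of_nonneg_right ?_ (by positivity)
          rw [← div_eq_mul_inv, div_le_one (by positivity)]
          nlinarith
      _ = _ := one_mul _
  have hsub : (Finset.univ.biUnion bad)ᶜ ⊆ Finset.univ.filter fun ω : Fin m → Fin (2 * ns - 1) =>
      ‖((N / (m : ℝ)) • ∑ j : Fin m, y (ω j) • Gop ns (Pi.single (ω j) 1))
        - Gop ns y‖ ≤ 2 * t := by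
    intro ω hω
    simp only [bad, Finset.mem_compl, Finset.mem_biUnion, Finset.mem_univ, true_and,
      Finset.mem_filter, not_exists, not_lt] at hω ⊢
    exact l2_opNorm_estimator_sub_le hζ y ω (by positivity) hω
  have hcard := Nat.cast_le (α := ℝ).2 (Finset.card_le_card hsub)
  rw [Finset.card_compl, Nat.cast_sub (Finset.card_le_univ _)] at hcard
  refine le_trans ?_ hcard
  have hc : (Fintype.card (Fin m → Fin (2 * ns - 1)) : ℝ) = N ^ m := by simp [hN]
  rw [hc]
  linarith

end Sampling

/-- Lemma 2 (initialization conditions), with i.i.d. uniform sampling expressed by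
counting uniform tuples `ω : Fin m̂ → Fin n`. -/
theorem initialization_conditions :
    ∃ C εbar : ℝ, 0 < C ∧ 0 < εbar ∧
    ∀ ε₀ : ℝ, 0 < ε₀ → ε₀ ≤ εbar →
    ∀ ns r : ℕ, ∀ hns : 1 ≤ ns, ∀ hr : 1 ≤ r,
    ∀ y : Fin (2 * ns - 1) → ℂ,
    ∀ Us : Matrix (Fin ns) (Fin r) ℂ, ∀ σvec : Fin r → ℝ,
    Usᴴ * Us = 1 →
    (∀ i j : Fin r, i ≤ j → σvec j ≤ σvec i) →
    0 < σvec ⟨r - 1, by omega⟩ →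
    Gop ns y = Us * Matrix.diagonal (fun k => (σvec k : ℂ)) * Usᵀ →
    ∀ μ₀ : ℝ, 0 < μ₀ →
    norm2inf Us ≤ Real.sqrt (2 * μ₀ * r / (2 * ns - 1 : ℕ)) →
    ∀ μ : ℝ, μ₀ ≤ μ →
    ∀ mhat : ℕ,
    C * ε₀⁻¹ ^ 2 * μ * (σvec ⟨0, by omega⟩ / σvec ⟨r - 1, by omega⟩) ^ 4 * r ^ 2
        * Real.log (2 * ns - 1 : ℕ) ≤ mhat →
    ((Finset.univ.filter (fun ω : Fin mhat → Fin (2 * ns - 1) =>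
      ∀ M0 : Matrix (Fin ns) (Fin ns) ℂ,
        M0.rank ≤ r →
        (∀ M' : Matrix (Fin ns) (Fin ns) ℂ, M'.rank ≤ r →
          specNorm (M0 - ((2 * ns - 1 : ℕ) / (mhat : ℝ)) •
              ∑ j : Fin mhat, y (ω j) • Gop ns (Pi.single (ω j) 1))
            ≤ specNorm (M' - ((2 * ns - 1 : ℕ) / (mhat : ℝ)) •
              ∑ j : Fin mhat, y (ω j) • Gop ns (Pi.single (ω j) 1))) →
        ∀ U0 : Matrix (Fin ns) (Fin r) ℂ, ∀ Sig0 : Fin r → ℝ,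
          U0ᴴ * U0 = 1 → (∀ k, 0 ≤ Sig0 k) →
          M0 = U0 * Matrix.diagonal (fun k => (Sig0 k : ℂ)) * U0ᵀ →
          ∀ σ : ℝ, σ = specNorm M0 / (1 - ε₀) →
          ∀ Z0 : Matrix (Fin ns) (Fin r) ℂ,
          Z0 = projC (2 * Real.sqrt (μ * r * σ / (2 * ns - 1 : ℕ)))
              (U0 * Matrix.diagonal (fun k => (Real.sqrt (Sig0 k) : ℂ))) →
          -- (i) σ ≥ σ₁(M⋆)
          σvec ⟨0, by omega⟩ ≤ σ
          -- (ii) distance bound after projection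
          ∧ distP Z0 (Us * Matrix.diagonal (fun k => (Real.sqrt (σvec k) : ℂ)))
              ≤ 1.6 * (σvec ⟨0, by omega⟩ / σvec ⟨r - 1, by omega⟩)⁻¹ * ε₀
                * Real.sqrt (σvec ⟨r - 1, by omega⟩)
          -- attainment of the infimum and (iii) singular value bounds
          ∧ ∃ P0 : Matrix (Fin r) (Fin r) ℂ, IsUnit P0 ∧
              Real.sqrt
                  (frobNorm (Z0 - Us * Matrix.diagonal
                      (fun k => (Real.sqrt (σvec k) : ℂ)) * P0) ^ 2
                    + frobNorm (Z0 - Us * Matrix.diagonal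
                      (fun k => (Real.sqrt (σvec k) : ℂ)) * (P0⁻¹)ᵀ) ^ 2)
                = distP Z0 (Us * Matrix.diagonal (fun k => (Real.sqrt (σvec k) : ℂ)))
              ∧ (∀ Zsi : Matrix (Fin ns) (Fin r) ℂ,
                  (Zsi = Us * Matrix.diagonal (fun k => (Real.sqrt (σvec k) : ℂ)) * P0
                    ∨ Zsi = Us * Matrix.diagonal
                        (fun k => (Real.sqrt (σvec k) : ℂ)) * (P0⁻¹)ᵀ) →
                  sigmaMin Zsi
                      ≥ (1 - 6.4 * (σvec ⟨0, by omega⟩ / σvec ⟨r - 1, by omega⟩)⁻¹ * ε₀)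
                        * Real.sqrt (σvec ⟨r - 1, by omega⟩)
                    ∧ specNorm Zsi
                      ≤ (1 + 6.4 * (σvec ⟨0, by omega⟩ / σvec ⟨r - 1, by omega⟩)⁻¹ * ε₀)
                        * Real.sqrt (σvec ⟨0, by omega⟩)))).card : ℝ)
      ≥ (1 - (((2 * ns - 1 : ℕ) : ℝ) ^ (2 : ℕ))⁻¹)
        * Fintype.card (Fin mhat → Fin (2 * ns - 1)) := by
  open scoped Matrix.Norms.L2Operator in
  refine ⟨12800000, 1 / 10, by norm_num, by norm_num, ?_⟩
  intro ε₀ hε0 hε1 ns r hns hr y Us σvec hU hmono hpos hM μ₀ hμ₀ hrow μ hμ mhat hmhat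
  rcases hns.eq_or_lt with rfl | hns2
  · norm_num
  set N : ℝ := ((2 * ns - 1 : ℕ) : ℝ) with hN
  have hN3 : (3 : ℝ) ≤ N := by
    rw [hN]
    exact_mod_cast (by omega : 3 ≤ 2 * ns - 1)
  have hN0 : 0 < N := by linarith
  set σ1 := σvec ⟨0, by omega⟩ with hσ1
  set σr := σvec ⟨r - 1, by omega⟩ with hσr
  have hs : ∀ k, σr ≤ σvec k := fun k => hmono _ _ (Fin.mk_le_mk.2 (by omega))
  have hs1 : ∀ k, σvec k ≤ σ1 := fun k => hmono _ _ (Fin.mk_le_mk.2 (by omega))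
  have hσ1r : σr ≤ σ1 := hs _
  have hσ10 : 0 < σ1 := hpos.trans_le hσ1r
  have habs : ∀ k, |σvec k| ≤ σ1 := fun k => by
    rw [abs_of_pos (hpos.trans_le (hs k))]
    exact hs1 k
  have hμ0 : 0 < μ := hμ₀.trans_le hμ
  have hr1 : (1 : ℝ) ≤ r := by exact_mod_cast hr
  have hr0 : (0 : ℝ) < r := by linarith
  set κ := σ1 / σr with hκ
  have hκ1 : 1 ≤ κ := (one_le_div hpos).2 hσ1r
  have hκ0 : 0 < κ := by linarith
  have hlog : 0 < Real.log N := Real.log_pos (by linarith)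
  have hm0 : (0 : ℝ) < mhat := lt_of_lt_of_le (by positivity) hmhat
  have hm : 0 < mhat := by exact_mod_cast hm0
  have hM' : Gop ns y = Us * realDiagonal σvec * Usᵀ := hM
  set ρ := 2 * μ * r / N with hρdef
  have hρ0 : 0 < ρ := by positivity
  have hρ : ∀ i, vecNorm (Us i) ^ 2 ≤ ρ := fun i => by
    have h1 := pow_le_pow_left₀ (vecNorm_nonneg _)
      ((vecNorm_row_le_norm2inf Us i).trans hrow) 2
    rw [Real.sq_sqrt (by positivity)] at h1
    exact h1.trans (by rw [hρdef]; gcongr)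
  have hsr : 1 ≤ √(r : ℝ) := Real.one_le_sqrt.2 hr1
  set t := ε₀ * σ1 / (400 * κ ^ 2 * √(r : ℝ)) with ht
  have ht0 : 0 < t := by positivity
  have hgood := le_card_filter_l2_opNorm_estimator_sub_le (m := mhat) hns2 hm y
    (B := σ1 * ρ) (V := 2 * (σ1 ^ 2 * ρ)) (t := t)
    (fun i j => by
      rw [hM']
      exact norm_mul_realDiagonal_mul_transpose_apply_le hσ10.le habs hρ i j)
    (fun i => by
      rw [hM', mul_div_cancel_left₀ _ (two_ne_zero)]
      exact sum_sq_row_mul_realDiagonal_mul_transpose_le hU hσ10.le habs hρ i)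
    (by positivity) ht0.le
    (by
      have h1 : t ≤ 2 * σ1 := by
        rw [ht, div_le_iff₀ (by positivity)]
        have h2 : 1 ≤ κ ^ 2 * √(r : ℝ) := one_le_mul_of_one_le_of_one_le (one_le_pow₀ hκ1) hsr
        have h3 := mul_le_mul_of_nonneg_left h2 hσ10.le
        have h4 := mul_le_mul_of_nonneg_right hε1 hσ10.le
        linarith
      calc t * (σ1 * ρ) ≤ 2 * σ1 * (σ1 * ρ) := by gcongr
        _ = _ := by ring)
    (by
      have h1 : mhat / N * t ^ 2 / (4 * (2 * (σ1 ^ 2 * ρ)))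
          = mhat * (ε₀ ^ 2 / (2560000 * κ ^ 4 * r ^ 2 * μ)) := by
        rw [ht, hρdef, div_pow, mul_pow, mul_pow, Real.sq_sqrt hr0.le]
        field_simp
        norm_num
      rw [← hN, h1]
      refine le_trans (le_of_eq ?_) (mul_le_mul_of_nonneg_right hmhat (by positivity))
      field_simp
      norm_num)
  refine ge_iff_le.2 (hgood.trans (Nat.cast_le.2 (Finset.card_le_card fun ω hω => ?_)))
  simp only [Finset.mem_filter, Finset.mem_univ, true_and] at hω ⊢
  intro M0 _ hbest U0 s0 hU0 hs0 hM0 σ hσ Z0 hZ0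
  have hMrank : (Gop ns y).rank ≤ r := by
    rw [hM, Matrix.mul_assoc]
    exact (Matrix.rank_mul_le_left _ _).trans
      ((Matrix.rank_le_card_width _).trans_eq (Fintype.card_fin r))
  have hM0' : M0 = U0 * realDiagonal s0 * U0ᵀ := hM0
  have hb := hbest _ hMrank
  rw [specNorm_eq_norm, specNorm_eq_norm, norm_sub_rev (Gop ns y)] at hb
  have hδ : ‖U0 * realDiagonal s0 * U0ᵀ - Us * realDiagonal σvec * Usᵀ‖ ≤ 4 * t := by
    rw [← hM0', ← hM']
    exact (norm_sub_le_norm_sub_add_norm_sub _ _ _).trans (by linarith)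
  have hδr : √(r : ℝ) * (4 * t) ≤ (σ1 / σr)⁻¹ * ε₀ * σr / 100 := by
    rw [ht, hκ]
    refine le_of_eq ?_
    field_simp
    norm_num
  exact initialization_of_close hr hε0 hε1 hU hU0 hpos hs hs1 ⟨_, rfl⟩ hs0 hN0 hμ₀ hμ hrow hδ
    hδr (by rw [hσ, specNorm_eq_norm, hM0']) hZ0
end
end
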